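/- arXiv:2007.13226 — 10 statements merged into one kernel-verified Lean document; each statement's English description precedes it below -/
import Mathlib

section
/- Let X be a compact Hausdorff topological space and let E be a uniformly dense Riesz subspace of C(X,ℝ), i.e. a linear subspace of the space of continuous real-valued functions on X that is closed under the pointwise lattice operations ⊔ and ⊓ and is dense with respect to the supremum norm. Then for every f ∈ C(X,ℝ) there exists a monotone increasing sequence (f_n) of elements of E that converges uniformly (in supremum norm) to f. -/
/-- Let `X` be a compact Hausdorff space and `E` a uniformly dense
Riesz subspace of `C(X, ℝ)` (a linear subspace closed under the pointwise lattice
operations `⊔` and `⊓`, dense in the supremum norm).  Then every `f ∈ C(X, ℝ)` is the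
uniform limit of a monotone increasing sequence of elements of `E`. -/
theorem dense_riesz_subspace_monotone_approx
    {X : Type*} [TopologicalSpace X] [CompactSpace X] [T2Space X]
    (E : Submodule ℝ C(X, ℝ))
    (hsup : ∀ f g : C(X, ℝ), f ∈ E → g ∈ E → f ⊔ g ∈ E)
    (hinf : ∀ f g : C(X, ℝ), f ∈ E → g ∈ E → f ⊓ g ∈ E)
    (hdense : Dense (E : Set C(X, ℝ)))
    (f : C(X, ℝ)) :
    ∃ u : ℕ → C(X, ℝ), (∀ n, u n ∈ E) ∧ Monotone u ∧
      Filter.Tendsto u Filter.atTop (nhds f) := by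
  have hq : ∀ n : ℕ, (0 : ℝ) < (1 / 3) ^ n := fun n => by positivity
  have hex : ∀ n : ℕ, ∃ g ∈ E,
      dist (f - ContinuousMap.const X (2 * (1 / 3 : ℝ) ^ n)) g < (1 / 3) ^ n :=
    fun n => hdense.exists_dist_lt _ (hq n)
  choose u hu hdist using hex
  have hbound : ∀ n x, |f x - 2 * (1 / 3 : ℝ) ^ n - u n x| < (1 / 3) ^ n := fun n x =>
    (ContinuousMap.dist_apply_le_dist x).trans_lt (hdist n)
  refine ⟨u, hu, monotone_nat_of_le_succ fun n x => ?_, ?_⟩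
  · have h₁ := abs_lt.1 (hbound n x)
    have h₂ := abs_lt.1 (hbound (n + 1) x)
    rw [pow_succ] at h₂
    change u n x ≤ u (n + 1) x
    linarith [h₁.1, h₂.2]
  · have hlim : Filter.Tendsto (fun n : ℕ => 3 * (1 / 3 : ℝ) ^ n) Filter.atTop (nhds 0) := by
      simpa using (tendsto_pow_atTop_nhds_zero_of_lt_one (r := (1 / 3 : ℝ))
        (by norm_num) (by norm_num)).const_mul 3
    refine tendsto_iff_dist_tendsto_zero.2
      (squeeze_zero (fun _ => dist_nonneg) (fun n => ?_) hlim)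
    refine (ContinuousMap.dist_le (by positivity)).2 fun x => ?_
    have h := abs_lt.1 (hbound n x)
    rw [Real.dist_eq, abs_le]
    constructor <;> linarith [h.1, h.2, hq n]
end

section
/- Let X be a compact Hausdorff topological space, let E be a uniformly dense Riesz subspace of C(X,ℝ), and let P be a prime ideal of E, i.e. a nonempty proper subset of E that is downward closed (if g ∈ E, f ∈ P and g ≤ f then g ∈ P), closed under the lattice operation ⊔, and satisfies: f ⊓ g ∈ P implies f ∈ P or g ∈ P. Then the closure Q of P in C(X,ℝ) with respect to the supremum norm is a prime ideal of C(X,ℝ): Q is a nonempty proper subset of C(X,ℝ), downward closed in C(X,ℝ), closed under ⊔, and f ⊓ g ∈ Q implies f ∈ Q or g ∈ Q for all f, g ∈ C(X,ℝ). -/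
theorem ContinuousMap.topologicalLattice {X : Type*} [TopologicalSpace X] [LocallyCompactPair X ℝ] :
    TopologicalLattice C(X, ℝ) where
  continuous_inf := continuous_of_continuous_uncurry _ <|
    (continuous_fst.fst.eval continuous_snd).inf (continuous_fst.snd.eval continuous_snd)
  continuous_sup := continuous_of_continuous_uncurry _ <|
    (continuous_fst.fst.eval continuous_snd).sup (continuous_fst.snd.eval continuous_snd)

/-- An element of `E` lying uniformly below a point of the closure of a downward closed set `P`
belongs to `P`. -/
theorem mem_of_add_le_of_mem_closure {X : Type*} [TopologicalSpace X] [CompactSpace X]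
    {E P : Set C(X, ℝ)} (hPdown : ∀ g ∈ E, ∀ f ∈ P, g ≤ f → g ∈ P)
    {h q : C(X, ℝ)} (hh : h ∈ E) (hq : q ∈ closure P) {δ : ℝ} (hδ : 0 < δ)
    (hle : ∀ x, h x + δ ≤ q x) : h ∈ P := by
  obtain ⟨p, hp, hqp⟩ := Metric.mem_closure_iff.1 hq δ hδ
  refine hPdown h hh p hp fun x => ?_
  have hx := (ContinuousMap.dist_apply_le_dist (f := q) (g := p) x).trans_lt hqp
  rw [Real.dist_eq, abs_lt] at hx
  exact (show h x ≤ p x by linarith [hle x, hx.2])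

/-- A dense set of continuous functions approximates every function strictly from below. -/
theorem exists_mem_dist_lt_add_le {X : Type*} [TopologicalSpace X] [CompactSpace X]
    {E : Set C(X, ℝ)} (hE : Dense E) (f : C(X, ℝ)) {ε : ℝ} (hε : 0 < ε) :
    ∃ e ∈ E, dist f e < ε ∧ ∀ x, e x + ε / 4 ≤ f x := by
  obtain ⟨e, he, hfe⟩ := hE.exists_dist_lt (f - ContinuousMap.const X (ε / 2))
    (show 0 < ε / 4 by positivity)
  have key : ∀ x, |f x - ε / 2 - e x| < ε / 4 := fun x =>
    (ContinuousMap.dist_apply_le_dist (f := f - ContinuousMap.const X (ε / 2))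
      (g := e) x).trans_lt hfe
  refine ⟨e, he, (ContinuousMap.dist_lt_iff hε).2 fun x => ?_, fun x => ?_⟩
  · have hx := abs_lt.1 (key x)
    rw [Real.dist_eq, abs_lt]
    constructor <;> linarith [hx.1, hx.2]
  · linarith [(abs_lt.1 (key x)).1]

/-- Let `X` be a compact Hausdorff space, `E` a uniformly dense Riesz
subspace of `C(X, ℝ)`, and `P` a prime ideal of `E` (a nonempty proper subset of `E`,
downward closed in `E`, closed under `⊔`, and such that `f ⊓ g ∈ P` implies `f ∈ P` or
`g ∈ P` for `f, g ∈ E`).  Then the supremum-norm closure of `P` in `C(X, ℝ)` is a prime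
ideal of `C(X, ℝ)`. -/
theorem closure_prime_ideal_is_prime_ideal
    {X : Type*} [TopologicalSpace X] [CompactSpace X] [T2Space X]
    (E : Submodule ℝ C(X, ℝ))
    (hsup : ∀ f g : C(X, ℝ), f ∈ E → g ∈ E → f ⊔ g ∈ E)
    (hinf : ∀ f g : C(X, ℝ), f ∈ E → g ∈ E → f ⊓ g ∈ E)
    (hdense : Dense (E : Set C(X, ℝ)))
    (P : Set C(X, ℝ))
    (hPE : P ⊆ (E : Set C(X, ℝ)))
    (hPne : P.Nonempty)
    (hPproper : P ≠ (E : Set C(X, ℝ)))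
    (hPdown : ∀ g ∈ E, ∀ f ∈ P, g ≤ f → g ∈ P)
    (hPsup : ∀ f ∈ P, ∀ g ∈ P, f ⊔ g ∈ P)
    (hPprime : ∀ f ∈ E, ∀ g ∈ E, f ⊓ g ∈ P → f ∈ P ∨ g ∈ P) :
    (closure P).Nonempty ∧ closure P ≠ Set.univ ∧
      (∀ f ∈ closure P, ∀ g : C(X, ℝ), g ≤ f → g ∈ closure P) ∧
      (∀ f ∈ closure P, ∀ g ∈ closure P, f ⊔ g ∈ closure P) ∧
      (∀ f g : C(X, ℝ), f ⊓ g ∈ closure P → f ∈ closure P ∨ g ∈ closure P) := by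
  have := ContinuousMap.topologicalLattice (X := X)
  refine ⟨hPne.closure, fun huniv => ?_, fun f hf g hgf => ?_, fun f hf g hg => ?_,
    fun f g hfg => ?_⟩
  · refine hPproper (hPE.antisymm fun f hf => ?_)
    exact mem_of_add_le_of_mem_closure hPdown hf
      (huniv ▸ Set.mem_univ (f + ContinuousMap.const X 1)) one_pos fun x => le_rfl
  · rw [← inf_eq_left.2 hgf]
    exact map_mem_closure₂ continuous_inf (hdense g) hf fun a ha b hb =>
      hPdown _ (hinf a b ha (hPE hb)) b hb inf_le_right
  · exact map_mem_closure₂ continuous_sup hf hg hPsup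
  · by_contra! hnot
    obtain ⟨hf, hg⟩ := hnot
    simp only [Metric.mem_closure_iff, not_forall, not_exists, not_and] at hf hg
    obtain ⟨ε, hε, hf⟩ := hf
    obtain ⟨η, hη, hg⟩ := hg
    obtain ⟨a, ha, hfa, hale⟩ := exists_mem_dist_lt_add_le hdense f hε
    obtain ⟨b, hb, hgb, hble⟩ := exists_mem_dist_lt_add_le hdense g hη
    have hab : a ⊓ b ∈ P := by
      refine mem_of_add_le_of_mem_closure hPdown (hinf a b ha hb) hfg
        (show 0 < min (ε / 4) (η / 4) by positivity) fun x => ?_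
      rw [ContinuousMap.inf_apply, ContinuousMap.inf_apply]
      exact le_inf ((add_le_add inf_le_left (min_le_left _ _)).trans (hale x))
        ((add_le_add inf_le_right (min_le_right _ _)).trans (hble x))
    rcases hPprime a ha b hb hab with h | h
    · exact hf a h hfa
    · exact hg b h hgb
end

section
/- Let X be a compact Hausdorff topological space, let E be a uniformly dense Riesz subspace of C(X,ℝ), and let P be a prime ideal of E. Then there exists a point x ∈ X such that P and the supremum-norm closure Q of P in C(X,ℝ) are associated with the same point x; that is: for all f ∈ P and g ∈ E, g(x) < f(x) implies g ∈ P, and for all f ∈ Q and g ∈ C(X,ℝ), g(x) < f(x) implies g ∈ Q. -/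
/-- Let `X` be a compact Hausdorff space, `E` a uniformly dense Riesz
subspace of `C(X, ℝ)`, and `P` a prime ideal of `E`.  Then there is a point `x ∈ X`
such that both `P` and the supremum-norm closure of `P` in `C(X, ℝ)` are associated
with `x`: whenever `f ∈ P`, `g ∈ E` and `g x < f x` we have `g ∈ P`, and whenever
`f ∈ closure P`, `g ∈ C(X, ℝ)` and `g x < f x` we have `g ∈ closure P`. -/
theorem prime_ideal_and_closure_associated_same_point
    {X : Type*} [TopologicalSpace X] [CompactSpace X] [T2Space X]
    (E : Submodule ℝ C(X, ℝ))
    (hsup : ∀ f g : C(X, ℝ), f ∈ E → g ∈ E → f ⊔ g ∈ E)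
    (hinf : ∀ f g : C(X, ℝ), f ∈ E → g ∈ E → f ⊓ g ∈ E)
    (hdense : Dense (E : Set C(X, ℝ)))
    (P : Set C(X, ℝ))
    (hPE : P ⊆ (E : Set C(X, ℝ)))
    (hPne : P.Nonempty)
    (hPproper : P ≠ (E : Set C(X, ℝ)))
    (hPdown : ∀ g ∈ E, ∀ f ∈ P, g ≤ f → g ∈ P)
    (hPsup : ∀ f ∈ P, ∀ g ∈ P, f ⊔ g ∈ P)
    (hPprime : ∀ f ∈ E, ∀ g ∈ E, f ⊓ g ∈ P → f ∈ P ∨ g ∈ P) :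
    ∃ x : X,
      (∀ f ∈ P, ∀ g ∈ E, g x < f x → g ∈ P) ∧
      (∀ f ∈ closure P, ∀ g : C(X, ℝ), g x < f x → g ∈ closure P) := by
  obtain ⟨x, hx⟩ : ∃ x : X, ∀ f ∈ P, ∀ g ∈ E, g x < f x → g ∈ P := by
    by_contra! h
    obtain ⟨f, hf, g, hg, hgP, hlt⟩ :
        ∃ f ∈ P, ∃ g ∈ E, g ∉ P ∧ ∀ x ∈ (Set.univ : Set X), g x < f x := by
      refine isCompact_univ.induction_on
        (p := fun s => ∃ f ∈ P, ∃ g ∈ E, g ∉ P ∧ ∀ x ∈ s, g x < f x) ?_ ?_ ?_ ?_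
      · obtain ⟨f, hf⟩ := hPne
        obtain ⟨g, hg, hgP⟩ := Set.exists_of_ssubset (hPE.ssubset_of_ne hPproper)
        exact ⟨f, hf, g, hg, hgP, by simp⟩
      · rintro s t hst ⟨f, hf, g, hg, hgP, hlt⟩
        exact ⟨f, hf, g, hg, hgP, fun x hx => hlt x (hst hx)⟩
      · rintro s t ⟨f, hf, g, hg, hgP, hs⟩ ⟨f', hf', g', hg', hgP', ht⟩
        refine ⟨f ⊔ f', hPsup f hf f' hf', g ⊓ g', hinf g g' hg hg',
          fun hP => (hPprime g hg g' hg' hP).elim hgP hgP', ?_⟩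
        rintro x (hx | hx)
        · exact inf_le_left.trans_lt ((hs x hx).trans_le le_sup_left)
        · exact inf_le_right.trans_lt ((ht x hx).trans_le le_sup_right)
      · intro x _
        obtain ⟨f, hf, g, hg, hlt, hgP⟩ := h x
        exact ⟨{y | g y < f y},
          mem_nhdsWithin_of_mem_nhds ((isOpen_lt g.continuous f.continuous).mem_nhds hlt),
          f, hf, g, hg, hgP, fun _ hy => hy⟩
    exact hgP (hPdown g hg f hf fun x => (hlt x trivial).le)
  refine ⟨x, hx, fun f hf g hgf => ?_⟩
  have heval : Continuous fun h : C(X, ℝ) => h x := continuous_eval_const x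
  obtain ⟨f', hgf', hf'⟩ :=
    mem_closure_iff.1 hf {h | g x < h x} (isOpen_lt continuous_const heval) hgf
  exact closure_mono (fun g' hg' => hx f' hf' g' hg'.2 hg'.1)
    (hdense.open_subset_closure_inter
      (isOpen_lt heval continuous_const : IsOpen {h : C(X, ℝ) | h x < f' x}) hgf')
end

section
/- Let X be a compact Hausdorff topological space and let E be a uniformly dense Riesz subspace of C(X,ℝ) containing the constant function 1. Let φ : E → ℝ be a lattice homomorphism (φ(f ⊔ g) = max(φ(f), φ(g)) and φ(f ⊓ g) = min(φ(f), φ(g)) for all f, g ∈ E) satisfying φ(λ·1) = λ for all λ ∈ ℝ. Then there exists a point x ∈ X such that φ(f) = f(x) for all f ∈ E, i.e. φ is the point evaluation map δ_x at x. -/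
/-- A lattice homomorphism on a sublattice of `C(X, ℝ)` that takes values on both sides of `t`
admits a point at which every function of value `< t` lies below every function of value `≥ t`. -/
lemma exists_point_le_of_lt_of_le {X : Type*} [TopologicalSpace X] [CompactSpace X]
    {E : Set C(X, ℝ)}
    (hsup : ∀ f g : C(X, ℝ), f ∈ E → g ∈ E → f ⊔ g ∈ E)
    (hinf : ∀ f g : C(X, ℝ), f ∈ E → g ∈ E → f ⊓ g ∈ E)
    {φ : C(X, ℝ) → ℝ}
    (hφsup : ∀ f ∈ E, ∀ g ∈ E, φ (f ⊔ g) = max (φ f) (φ g))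
    (hφinf : ∀ f ∈ E, ∀ g ∈ E, φ (f ⊓ g) = min (φ f) (φ g))
    {t : ℝ} (hlt : ∃ f ∈ E, φ f < t) (hle : ∃ g ∈ E, t ≤ φ g) :
    ∃ x : X, ∀ f ∈ E, ∀ g ∈ E, φ f < t → t ≤ φ g → f x ≤ g x := by
  by_contra! hx
  obtain ⟨f, hf, g, hg, hft, hgt, hgf⟩ : ∃ f ∈ E, ∃ g ∈ E, φ f < t ∧ t ≤ φ g ∧
      ∀ x ∈ (Set.univ : Set X), g x < f x := by
    refine isCompact_univ.induction_on
      (p := fun S => ∃ f ∈ E, ∃ g ∈ E, φ f < t ∧ t ≤ φ g ∧ ∀ x ∈ S, g x < f x) ?_ ?_ ?_ ?_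
    · obtain ⟨f, hf, hft⟩ := hlt
      obtain ⟨g, hg, hgt⟩ := hle
      exact ⟨f, hf, g, hg, hft, hgt, by simp⟩
    · rintro S T hST ⟨f, hf, g, hg, hft, hgt, h⟩
      exact ⟨f, hf, g, hg, hft, hgt, fun x hxS => h x (hST hxS)⟩
    · rintro S T ⟨f, hf, g, hg, hft, hgt, h⟩ ⟨f', hf', g', hg', hft', hgt', h'⟩
      refine ⟨f ⊔ f', hsup f f' hf hf', g ⊓ g', hinf g g' hg hg', ?_, ?_, ?_⟩
      · rw [hφsup f hf f' hf']
        exact max_lt hft hft'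
      · rw [hφinf g hg g' hg']
        exact le_min hgt hgt'
      · rintro x (hxS | hxT)
        · exact (min_le_left _ _).trans_lt ((h x hxS).trans_le (le_max_left _ _))
        · exact (min_le_right _ _).trans_lt ((h' x hxT).trans_le (le_max_right _ _))
    · intro x _
      obtain ⟨f, hf, g, hg, hft, hgt, h⟩ := hx x
      exact ⟨{y | g y < f y}, mem_nhdsWithin_of_mem_nhds
        ((isOpen_lt g.continuous f.continuous).mem_nhds h), f, hf, g, hg, hft, hgt, fun _ => id⟩
  have hmin := hφinf g hg f hf
  rw [inf_eq_left.2 (ContinuousMap.le_def.2 fun x => (hgf x trivial).le)] at hmin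
  exact absurd (hmin.le.trans (min_le_right _ _)) (hft.trans_le hgt).not_ge

/-- A dense set of continuous functions separates points with arbitrarily prescribed gaps. -/
lemma Dense.exists_continuousMap_lt_lt {X : Type*} [TopologicalSpace X] [CompactSpace X]
    [T2Space X] {E : Set C(X, ℝ)} (hE : Dense E) {x y : X} (hxy : x ≠ y) (a b : ℝ) :
    ∃ h ∈ E, h x < a ∧ b < h y := by
  obtain ⟨u, hux, huy, -⟩ := exists_continuous_zero_one_of_isClosed
    (isClosed_singleton (x := x)) (isClosed_singleton (x := y)) (by simpa using hxy)
  have hopen : IsOpen ({h : C(X, ℝ) | h x < a} ∩ {h : C(X, ℝ) | b < h y}) :=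
    (isOpen_lt (continuous_eval_const x) continuous_const).inter
      (isOpen_lt continuous_const (continuous_eval_const y))
  refine hE.exists_mem_open hopen
    ⟨ContinuousMap.const X (a - 1) + (b - a + 2) • u, ?_, ?_⟩
  · have : u x = 0 := hux rfl
    simp [this]
  · have : u y = 1 := huy rfl
    simp only [ContinuousMap.add_apply, ContinuousMap.const_apply, ContinuousMap.smul_apply,
      smul_eq_mul, this]
    linarith

/-- Let `X` be a compact Hausdorff space, `E` a uniformly dense Riesz
subspace of `C(X, ℝ)` containing the constant function `1`, and `φ` a real-valued
lattice homomorphism on `E` fixing the constants (`φ (c • 1) = c` for all `c : ℝ`).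
Then `φ` is evaluation at some point `x ∈ X`. -/
theorem lattice_hom_fixing_constants_is_point_evaluation
    {X : Type*} [TopologicalSpace X] [CompactSpace X] [T2Space X]
    (E : Submodule ℝ C(X, ℝ))
    (hsup : ∀ f g : C(X, ℝ), f ∈ E → g ∈ E → f ⊔ g ∈ E)
    (hinf : ∀ f g : C(X, ℝ), f ∈ E → g ∈ E → f ⊓ g ∈ E)
    (hdense : Dense (E : Set C(X, ℝ)))
    (hone : (1 : C(X, ℝ)) ∈ E)
    (φ : C(X, ℝ) → ℝ)
    (hφsup : ∀ f ∈ E, ∀ g ∈ E, φ (f ⊔ g) = max (φ f) (φ g))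
    (hφinf : ∀ f ∈ E, ∀ g ∈ E, φ (f ⊓ g) = min (φ f) (φ g))
    (hφconst : ∀ c : ℝ, φ (c • (1 : C(X, ℝ))) = c) :
    ∃ x : X, ∀ f ∈ E, φ f = f x := by
  have hc : ∀ c : ℝ, c • (1 : C(X, ℝ)) ∈ E := fun c => E.smul_mem c hone
  have hpt : ∀ t : ℝ, ∃ x : X, ∀ f ∈ E, ∀ g ∈ E, φ f < t → t ≤ φ g → f x ≤ g x := fun t =>
    exists_point_le_of_lt_of_le (E := (E : Set C(X, ℝ))) hsup hinf hφsup hφinf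
      ⟨(t - 1) • 1, hc _, by rw [hφconst]; linarith⟩ ⟨t • 1, hc t, (hφconst t).ge⟩
  choose p hp using hpt
  have hne : ∀ s t : ℝ, s < t → p s = p t := by
    intro s t hst
    by_contra hpst
    obtain ⟨h, hh, hs, ht⟩ := hdense.exists_continuousMap_lt_lt hpst (s - 1) t
    rcases lt_or_ge (φ h) t with hlt | hge
    · have := hp t h hh _ (hc t) hlt (hφconst t).ge
      simp only [ContinuousMap.smul_apply, ContinuousMap.one_apply, smul_eq_mul] at this
      linarith
    · have := hp s _ (hc (s - 1)) h hh (by rw [hφconst]; linarith) (hst.le.trans hge)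
      simp only [ContinuousMap.smul_apply, ContinuousMap.one_apply, smul_eq_mul] at this
      linarith
  have hp0 : ∀ t : ℝ, p t = p 0 := by
    intro t
    rcases lt_trichotomy t 0 with h | rfl | h
    · exact hne t 0 h
    · rfl
    · exact (hne 0 t h).symm
  refine ⟨p 0, fun f hf => le_antisymm ?_ ?_⟩
  · refine le_of_forall_lt_imp_le_of_dense fun s hs => ?_
    have := hp (φ f) _ (hc s) f hf (by rwa [hφconst]) le_rfl
    simpa [hp0] using this
  · refine le_of_forall_gt_imp_ge_of_dense fun t ht => ?_
    have := hp t f hf _ (hc t) ht (hφconst t).ge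
    simpa [hp0] using this
end

section
/- Let E be an Archimedean Riesz space with a strong order unit e (i.e. e ≥ 0 and for every x ∈ E there exists λ ∈ ℝ, λ ≥ 0, with |x| ≤ λ·e), let F be an Archimedean Riesz space, and let T : E → F be a lattice homomorphism (a map, not assumed linear, satisfying T(x ⊔ y) = T(x) ⊔ T(y) and T(x ⊓ y) = T(x) ⊓ T(y)) such that T(λ·e) = λ·T(e) for every λ ∈ ℝ. Then T is linear, i.e. T(x + y) = T(x) + T(y) and T(c·x) = c·T(x) for all x, y ∈ E and c ∈ ℝ; hence T is a Riesz homomorphism. -/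
section RieszSpace

variable {E : Type*} [AddCommGroup E] [Lattice E] [IsOrderedAddMonoid E]
  [Module ℝ E] [PosSMulMono ℝ E]

/-- The positive cone of an order ideal of a Riesz space. -/
structure IsPositiveIdeal (P : Set E) : Prop where
  nonneg : ∀ u ∈ P, 0 ≤ u
  zero_mem : 0 ∈ P
  add_mem : ∀ u ∈ P, ∀ v ∈ P, u + v ∈ P
  mem_of_le : ∀ u ∈ P, ∀ v, 0 ≤ v → v ≤ u → v ∈ P

theorem smul_inf_smul_eq_zero {E : Type*} [AddCommGroup E] [Lattice E] [Module ℝ E]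
    [PosSMulMono ℝ E] {u v : E} (h : u ⊓ v = 0) {c : ℝ} (hc : 0 ≤ c) :
    c • u ⊓ c • v = 0 := by
  rcases hc.eq_or_lt with rfl | hc
  · simp
  · have := (OrderIso.smulRight (β := E) hc).map_inf u v
    simpa [h] using this.symm

theorem smul_inf_smul_eq_zero' {u v : E} (h : u ⊓ v = 0) {c d : ℝ} (hc : 0 ≤ c) (hd : 0 ≤ d) :
    c • u ⊓ d • v = 0 := by
  have hu : 0 ≤ u := h ▸ inf_le_left
  have hv : 0 ≤ v := h ▸ inf_le_right
  apply le_antisymm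
  · rw [← smul_inf_smul_eq_zero h (le_max_of_le_left hc : 0 ≤ max c d)]
    exact inf_le_inf (smul_le_smul_of_nonneg_right (le_max_left _ _) hu)
      (smul_le_smul_of_nonneg_right (le_max_right _ _) hv)
  · exact le_inf (smul_nonneg hc hu) (smul_nonneg hd hv)

/-- A supremum is nonnegative as soon as some positive combination is. -/
theorem sup_nonneg_of_smul_add_nonneg {u v : E} {k : ℝ} (hk : 0 ≤ k) (h : 0 ≤ k • u + v) :
    0 ≤ u ⊔ v := by
  have h1 : 0 ≤ (k + 1) • (u ⊔ v) := by
    rw [add_smul, one_smul]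
    exact h.trans (add_le_add (smul_le_smul_of_nonneg_left le_sup_left hk) le_sup_right)
  have h2 := smul_nonneg (inv_nonneg.2 (by linarith : (0 : ℝ) ≤ k + 1)) h1
  rwa [inv_smul_smul₀ (by linarith)] at h2

theorem posPart_add_le_add_posPart {E : Type*} [AddCommGroup E] [Lattice E]
    [IsOrderedAddMonoid E] (u v : E) : (u + v)⁺ ≤ u⁺ + v⁺ :=
  sup_le (add_le_add (le_posPart _) (le_posPart _))
    (add_nonneg (posPart_nonneg _) (posPart_nonneg _))

namespace IsPositiveIdeal

variable {P : Set E}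

theorem smul_mem (hP : IsPositiveIdeal P) {u : E} (hu : u ∈ P) {c : ℝ} (hc : 0 ≤ c) :
    c • u ∈ P := by
  have hn : ∀ n : ℕ, n • u ∈ P := by
    intro n
    induction n with
    | zero => simpa using hP.zero_mem
    | succ k ih => rw [succ_nsmul]; exact hP.add_mem _ ih _ hu
  obtain ⟨n, hn'⟩ := exists_nat_ge c
  refine hP.mem_of_le _ (hn n) _ (smul_nonneg hc (hP.nonneg _ hu)) ?_
  rw [← Nat.cast_smul_eq_nsmul ℝ]
  exact smul_le_smul_of_nonneg_right hn' (hP.nonneg _ hu)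

theorem adjoin {E : Type*} [AddCommGroup E] [Lattice E] [IsOrderedAddMonoid E] [Module ℝ E]
    {P : Set E} (hP : IsPositiveIdeal P) (u : E) :
    IsPositiveIdeal {z : E | 0 ≤ z ∧ ∃ p ∈ P, ∃ c : ℝ, 0 ≤ c ∧ z ≤ p + c • u} where
  nonneg z hz := hz.1
  zero_mem := ⟨le_rfl, 0, hP.zero_mem, 0, le_rfl, by simp⟩
  add_mem := by
    rintro z ⟨hz, p, hp, c, hc, h⟩ z' ⟨hz', p', hp', c', hc', h'⟩
    refine ⟨add_nonneg hz hz', p + p', hP.add_mem _ hp _ hp', c + c', add_nonneg hc hc', ?_⟩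
    calc z + z' ≤ (p + c • u) + (p' + c' • u) := add_le_add h h'
      _ = _ := by module
  mem_of_le := by
    rintro z ⟨-, p, hp, c, hc, h⟩ y hy hyz
    exact ⟨hy, p, hp, c, hc, hyz.trans h⟩

end IsPositiveIdeal

/-- A nonzero positive element is avoided by the positive cone of some prime ideal. -/
theorem exists_prime_isPositiveIdeal {w : E} (hw : 0 ≤ w) (hw0 : w ≠ 0) :
    ∃ P : Set E, IsPositiveIdeal P ∧ w ∉ P ∧ ∀ u : E, u⁺ ∈ P ∨ u⁻ ∈ P := by
  obtain ⟨P, -, hmax⟩ := zorn_subset_nonempty {P : Set E | IsPositiveIdeal P ∧ w ∉ P}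
    (by
      intro C hC hchain hne
      obtain ⟨Q, hQ⟩ := hne
      refine ⟨⋃₀ C, ⟨⟨?_, ?_, ?_, ?_⟩, ?_⟩, fun s hs => Set.subset_sUnion_of_mem hs⟩
      · rintro u ⟨R, hR, hu⟩
        exact (hC hR).1.nonneg u hu
      · exact ⟨Q, hQ, (hC hQ).1.zero_mem⟩
      · rintro u ⟨R, hR, hu⟩ v ⟨S, hS, hv⟩
        rcases hchain.total hR hS with h | h
        · exact ⟨S, hS, (hC hS).1.add_mem _ (h hu) _ hv⟩
        · exact ⟨R, hR, (hC hR).1.add_mem _ hu _ (h hv)⟩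
      · rintro u ⟨R, hR, hu⟩ v hv hvu
        exact ⟨R, hR, (hC hR).1.mem_of_le u hu v hv hvu⟩
      · rintro ⟨R, hR, hu⟩
        exact (hC hR).2 hu)
    {0} ⟨⟨by simp, by simp, by simp, by
      rintro u rfl v hv hvu
      exact le_antisymm hvu hv⟩, by simpa using hw0⟩
  have hP : IsPositiveIdeal P := hmax.prop.1
  have key : ∀ u : E, 0 ≤ u → u ∉ P → ∃ p ∈ P, ∃ c : ℝ, 0 ≤ c ∧ w ≤ p + c • u := by
    intro u hu huP
    by_contra hcon
    have hle := hmax.le_of_ge (y := {z : E | 0 ≤ z ∧ ∃ p ∈ P, ∃ c : ℝ, 0 ≤ c ∧ z ≤ p + c • u})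
      ⟨hP.adjoin u, fun h => hcon h.2⟩
      (fun p hp => ⟨hP.nonneg p hp, p, hp, 0, le_rfl, by simp⟩)
    exact huP (hle ⟨hu, 0, hP.zero_mem, 1, zero_le_one, by simp⟩)
  refine ⟨P, hP, hmax.prop.2, fun u => ?_⟩
  by_contra! hcon
  obtain ⟨p, hp, c, hc, h⟩ := key _ (posPart_nonneg u) hcon.1
  obtain ⟨q, hq, d, hd, h'⟩ := key _ (negPart_nonneg u) hcon.2
  refine hmax.prop.2 (hP.mem_of_le _ (hP.add_mem _ hp _ hq) w hw ?_)
  have h1 : w ≤ p + q + c • u⁺ :=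
    h.trans (add_le_add_left (le_add_of_nonneg_right (hP.nonneg q hq)) _)
  have h2 : w ≤ p + q + d • u⁻ :=
    h'.trans (add_le_add_left (le_add_of_nonneg_left (hP.nonneg p hp)) _)
  have h3 := le_inf h1 h2
  rwa [← add_inf, smul_inf_smul_eq_zero' (posPart_inf_negPart_eq_zero u) hc hd, add_zero] at h3

/-- In an Archimedean Riesz space, the real-valued Riesz homomorphisms on the ideal generated by
`a` that map `a` to `1` detect non-positivity. -/
theorem exists_real_hom_pos (hArch : ∀ x y : E, (∀ n : ℕ, n • x ≤ y) → x ≤ 0)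
    {a : E} (ha : 0 ≤ a) {v : E} (hv : ¬ v ≤ 0) (hva : ∃ c : ℝ, v ≤ c • a) :
    ∃ φ : E → ℝ, 0 < φ v ∧ (∀ c : ℝ, φ (c • a) = c) ∧
      (∀ x y : E, (∃ c : ℝ, |x| ≤ c • a) → (∃ c : ℝ, |y| ≤ c • a) →
        φ (x + y) = φ x + φ y ∧ φ (x ⊔ y) = φ x ⊔ φ y) := by
  obtain ⟨n, hn⟩ : ∃ n : ℕ, ¬ n • v ≤ a := by
    by_contra! h
    exact hv (hArch v a h)
  have hn0 : n ≠ 0 := by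
    rintro rfl
    simp [ha] at hn
  have hnpos : (0 : ℝ) < n := by positivity
  have hw0 : (v - (n : ℝ)⁻¹ • a)⁺ ≠ 0 := by
    intro h
    rw [posPart_eq_zero, sub_nonpos] at h
    apply hn
    have := smul_le_smul_of_nonneg_left h hnpos.le
    rwa [smul_inv_smul₀ hnpos.ne', Nat.cast_smul_eq_nsmul] at this
  obtain ⟨P, hP, hwP, hprime⟩ := exists_prime_isPositiveIdeal (posPart_nonneg _) hw0
  have hca : ∀ c : ℝ, 0 < c → c • a ∉ P := by
    intro c hc hcP
    obtain ⟨d, hd⟩ := hva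
    have haP : a ∈ P := by simpa [hc.ne'] using hP.smul_mem hcP (inv_nonneg.2 hc.le)
    refine hwP (hP.mem_of_le _ (hP.smul_mem haP (abs_nonneg d)) _ (posPart_nonneg _) ?_)
    refine sup_le ?_ (smul_nonneg (abs_nonneg d) ha)
    exact (sub_le_self _ (smul_nonneg (inv_nonneg.2 hnpos.le) ha)).trans
      (hd.trans (smul_le_smul_of_nonneg_right (le_abs_self d) ha))
  have hmono : ∀ {x y : E}, x ≤ y → y⁺ ∈ P → x⁺ ∈ P := fun hxy hy =>
    hP.mem_of_le _ hy _ (posPart_nonneg _) (posPart_mono hxy)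
  have hsa : ∀ {s t : ℝ} (x : E), s ≤ t → x - t • a ≤ x - s • a := fun x hst =>
    sub_le_sub_left (smul_le_smul_of_nonneg_right hst ha) x
  set φ : E → ℝ := fun x => sInf {s : ℝ | (x - s • a)⁺ ∈ P} with hφ
  have hne : ∀ {x : E}, (∃ c : ℝ, x ≤ c • a) → {s : ℝ | (x - s • a)⁺ ∈ P}.Nonempty := by
    rintro x ⟨c, hc⟩
    refine ⟨c, ?_⟩
    change (x - c • a)⁺ ∈ P
    rw [posPart_eq_zero.2 (sub_nonpos.2 hc)]
    exact hP.zero_mem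
  have hbdd : ∀ {x : E}, (∃ c : ℝ, -x ≤ c • a) → BddBelow {s : ℝ | (x - s • a)⁺ ∈ P} := by
    rintro x ⟨c, hc⟩
    refine ⟨-c, fun s hs => ?_⟩
    by_contra! hlt
    refine hca (-c - s) (by linarith) (hP.mem_of_le _ hs _ (smul_nonneg (by linarith) ha) ?_)
    refine le_trans ?_ (le_posPart _)
    rw [sub_smul, neg_smul]
    exact sub_le_sub_right (neg_le.1 hc) _
  have hle : ∀ {x : E} {s : ℝ}, (∃ c : ℝ, |x| ≤ c • a) → (x - s • a)⁺ ∈ P → φ x ≤ s := by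
    rintro x s ⟨c, hc⟩ hs
    exact csInf_le (hbdd ⟨c, (neg_le_abs x).trans hc⟩) hs
  have hlt : ∀ {x : E} {s : ℝ}, (∃ c : ℝ, |x| ≤ c • a) → φ x < s → (x - s • a)⁺ ∈ P := by
    rintro x s ⟨c, hc⟩ hs
    obtain ⟨t, ht, hts⟩ := exists_lt_of_csInf_lt (hne ⟨c, (le_abs_self x).trans hc⟩) hs
    exact hmono (hsa x hts.le) ht
  have hbadd : ∀ {x y : E}, (∃ c : ℝ, |x| ≤ c • a) → (∃ c : ℝ, |y| ≤ c • a) →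
      ∃ c : ℝ, |x + y| ≤ c • a := by
    rintro x y ⟨c, hc⟩ ⟨d, hd⟩
    refine ⟨c + d, (abs_add_le x y).trans ?_⟩
    rw [add_smul]
    exact add_le_add hc hd
  have hbneg : ∀ {x : E}, (∃ c : ℝ, |x| ≤ c • a) → ∃ c : ℝ, |-x| ≤ c • a := by
    simp
  have hbsup : ∀ {x y : E}, (∃ c : ℝ, |x| ≤ c • a) → (∃ c : ℝ, |y| ≤ c • a) →
      ∃ c : ℝ, |x ⊔ y| ≤ c • a := by
    rintro x y ⟨c, hc⟩ ⟨d, hd⟩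
    have hc' := hc.trans (smul_le_smul_of_nonneg_right (le_max_left c d) ha)
    have hd' := hd.trans (smul_le_smul_of_nonneg_right (le_max_right c d) ha)
    refine ⟨max c d, abs_le'.2 ⟨sup_le ((le_abs_self x).trans hc') ((le_abs_self y).trans hd'), ?_⟩⟩
    exact (neg_le_neg le_sup_left).trans ((neg_le_abs x).trans hc')
  have hφa : ∀ c : ℝ, φ (c • a) = c := by
    intro c
    have hb : ∃ d : ℝ, |c • a| ≤ d • a := by
      refine ⟨|c|, abs_le'.2 ⟨smul_le_smul_of_nonneg_right (le_abs_self c) ha, ?_⟩⟩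
      rw [← neg_smul]
      exact smul_le_smul_of_nonneg_right (neg_le_abs c) ha
    apply le_antisymm
    · exact hle hb (by simpa using hP.zero_mem)
    · by_contra! h
      obtain ⟨s, hs, hsc⟩ := exists_between h
      have := hlt hb hs
      rw [← sub_smul, posPart_of_nonneg (smul_nonneg (by linarith) ha)] at this
      exact hca _ (by linarith) this
  have hsub : ∀ {x y : E}, (∃ c : ℝ, |x| ≤ c • a) → (∃ c : ℝ, |y| ≤ c • a) →
      φ (x + y) ≤ φ x + φ y := by
    intro x y hx hy
    refine le_of_forall_pos_lt_add' fun ε hε => ?_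
    refine lt_of_le_of_lt (hle (s := (φ x + ε / 3) + (φ y + ε / 3)) (hbadd hx hy) ?_) (by linarith)
    refine hP.mem_of_le _ (hP.add_mem _ (hlt hx (by linarith : φ x < φ x + ε / 3)) _
      (hlt hy (by linarith : φ y < φ y + ε / 3))) _ (posPart_nonneg _) ?_
    rw [add_smul, add_sub_add_comm]
    exact posPart_add_le_add_posPart _ _
  have hneg : ∀ {x : E}, (∃ c : ℝ, |x| ≤ c • a) → φ (-x) ≤ -φ x := by
    intro x hx
    refine le_of_forall_gt_imp_ge_of_dense fun t ht => hle (hbneg hx) ?_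
    have h := (hprime (x - (-t) • a)).resolve_left fun h => by
      linarith [hle hx h]
    rw [← posPart_neg] at h
    convert h using 2
    module
  refine ⟨φ, ?_, hφa, fun x y hx hy => ⟨le_antisymm (hsub hx hy) ?_, le_antisymm ?_ ?_⟩⟩
  · refine lt_of_lt_of_le (inv_pos.2 hnpos) (le_csInf (hne hva) fun s hs => ?_)
    by_contra! hlt
    exact hwP (hmono (hsa v hlt.le) hs)
  · have h1 := hsub (hbadd hx hy) (hbneg hy)
    rw [add_neg_cancel_right] at h1
    linarith [hneg hy]
  · refine le_of_forall_gt_imp_ge_of_dense fun t ht => hle (hbsup hx hy) ?_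
    have hx' := hlt hx (le_sup_left.trans_lt ht)
    have hy' := hlt hy (le_sup_right.trans_lt ht)
    refine hP.mem_of_le _ (hP.add_mem _ hx' _ hy') _ (posPart_nonneg _) ?_
    refine sup_le ?_ (add_nonneg (posPart_nonneg _) (posPart_nonneg _))
    rw [sub_le_iff_le_add]
    refine sup_le ?_ ?_ <;> rw [← sub_le_iff_le_add]
    · exact (le_posPart _).trans (le_add_of_nonneg_right (posPart_nonneg _))
    · exact (le_posPart _).trans (le_add_of_nonneg_left (posPart_nonneg _))
  · have hm : ∀ z : E, z ≤ x ⊔ y → (∃ c : ℝ, |z| ≤ c • a) → φ z ≤ φ (x ⊔ y) := fun z hz hb =>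
      le_of_forall_gt_imp_ge_of_dense fun t ht =>
        hle hb (hmono (sub_le_sub_right hz _) (hlt (hbsup hx hy) ht))
    exact sup_le (hm x le_sup_left hx) (hm y le_sup_right hy)

/-- A real-valued lattice homomorphism that is the identity on the multiples of `e` cannot see
the part of `x` above a level exceeding its value at `x`. -/
theorem map_smul_add_smul_posPart_le {e : E} (G : E → ℝ)
    (hsup : ∀ x y : E, G (x ⊔ y) = G x ⊔ G y) (hinf : ∀ x y : E, G (x ⊓ y) = G x ⊓ G y)
    (hGe : ∀ c : ℝ, G (c • e) = c) (he : 0 ≤ e) {x : E} {s : ℝ} (hs : G x < s)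
    (r : ℝ) {k : ℝ} (hk : 0 ≤ k) : G (r • e + k • (x - s • e)⁺) ≤ r := by
  have hmono : Monotone G := fun u v huv => by
    rw [← sup_eq_right.2 huv, hsup]
    exact le_sup_left
  have hp := posPart_nonneg (x - s • e)
  have low : ∀ r k : ℝ, r < s → 0 ≤ k → G (r • e + k • (x - s • e)⁺) ≤ r := by
    intro r k hr hk
    obtain ⟨t, ht, hts⟩ := exists_between (max_lt hs hr)
    rw [max_lt_iff] at ht
    set m : ℝ := (t - r) / (s - t) with hm
    have hst : 0 < s - t := by linarith
    have hm0 : 0 ≤ m := div_nonneg (by linarith) hst.le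
    have hmst : m * (s - t) = t - r := by rw [hm]; field_simp
    have h1 : G (r • e + k • (x - s • e)⁺) ⊓ G (r • e + m • (x - s • e)⁻) = r := by
      rw [← hinf, ← add_inf, smul_inf_smul_eq_zero' (posPart_inf_negPart_eq_zero _) hk hm0,
        add_zero, hGe]
    have h2 : t • e ≤ x ⊔ (r • e + m • (x - s • e)⁻) := by
      have h3 : 0 ≤ (x - t • e) ⊔ ((r • e + m • (x - s • e)⁻) - t • e) := by
        apply sup_nonneg_of_smul_add_nonneg hm0
        have h4 : 0 ≤ m • ((x - s • e)⁻ - -(x - s • e)) :=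
          smul_nonneg hm0 (sub_nonneg.2 (neg_le_negPart _))
        convert h4 using 1
        have : (m * (s - t)) • e = (t - r) • e := by rw [hmst]
        linear_combination (norm := module) this
      have h5 := sup_le (sub_le_sub_right (le_sup_left : x ≤ x ⊔ (r • e + m • (x - s • e)⁻)) (t • e))
        (sub_le_sub_right le_sup_right (t • e))
      exact sub_nonneg.1 (h3.trans h5)
    have h6 := hmono h2
    rw [hsup, hGe] at h6
    have h7 : t ≤ G (r • e + m • (x - s • e)⁻) := (le_sup_iff.1 h6).resolve_left (by linarith)
    rcases min_choice (G (r • e + k • (x - s • e)⁺)) (G (r • e + m • (x - s • e)⁻)) with h | h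
    · exact (h.symm.trans h1).le
    · have := h.symm.trans h1
      linarith
  refine le_of_forall_gt_imp_ge_of_dense fun t ht => ?_
  obtain ⟨r₀, hr₀⟩ := exists_lt (min s t)
  rw [lt_min_iff] at hr₀
  set l : ℝ := (t - r₀) / (t - r) with hl
  have htr : 0 < t - r := by linarith
  have hl0 : 0 ≤ l := div_nonneg (by linarith) htr.le
  have hltr : l * (t - r) = t - r₀ := by rw [hl]; field_simp
  have h1 : r • e + k • (x - s • e)⁺ ≤ t • e ⊔ (r₀ • e + ((l + 1) * k) • (x - s • e)⁺) := by
    set p := (x - s • e)⁺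
    have h2 : 0 ≤ (t • e - (r • e + k • p)) ⊔
        ((r₀ • e + ((l + 1) * k) • p) - (r • e + k • p)) := by
      apply sup_nonneg_of_smul_add_nonneg hl0
      have h3 : 0 ≤ (t - r) • e := smul_nonneg htr.le he
      convert h3 using 1
      have : (l * (t - r)) • e = (t - r₀) • e := by rw [hltr]
      linear_combination (norm := module) this
    refine sub_nonneg.1 (h2.trans (sup_le ?_ ?_))
    · exact sub_le_sub_right le_sup_left _
    · exact sub_le_sub_right le_sup_right _
  have h4 := hmono h1
  rw [hsup, hGe] at h4
  refine h4.trans (sup_le le_rfl ?_)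
  exact (low r₀ _ hr₀.1 (mul_nonneg (by linarith) hk)).trans hr₀.2.le

theorem real_latticeHom_subadditive {e : E} (G : E → ℝ)
    (hsup : ∀ x y : E, G (x ⊔ y) = G x ⊔ G y) (hinf : ∀ x y : E, G (x ⊓ y) = G x ⊓ G y)
    (hGe : ∀ c : ℝ, G (c • e) = c) (he : 0 ≤ e) (x y : E) : G (x + y) ≤ G x + G y := by
  have hmono : Monotone G := fun u v huv => by
    rw [← sup_eq_right.2 huv, hsup]
    exact le_sup_left
  refine le_of_forall_pos_lt_add' fun ε hε => ?_
  set s := G x + ε / 3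
  set t := G y + ε / 3
  have hx := map_smul_add_smul_posPart_le G hsup hinf hGe he
    (by simp only [s]; linarith : G x < s) (s + t) zero_le_two
  have hy := map_smul_add_smul_posPart_le G hsup hinf hGe he
    (by simp only [t]; linarith : G y < t) (s + t) zero_le_two
  set p := (x - s • e)⁺
  set q := (y - t • e)⁺
  have h1 : x + y ≤ ((s + t) • e + (2 : ℝ) • p) ⊔ ((s + t) • e + (2 : ℝ) • q) := by
    have h2 : 0 ≤ (((s + t) • e + (2 : ℝ) • p) - (x + y)) ⊔
        (((s + t) • e + (2 : ℝ) • q) - (x + y)) := by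
      apply sup_nonneg_of_smul_add_nonneg zero_le_one
      have h3 : 0 ≤ (2 : ℝ) • ((p - (x - s • e)) + (q - (y - t • e))) :=
        smul_nonneg zero_le_two
          (add_nonneg (sub_nonneg.2 (le_posPart _)) (sub_nonneg.2 (le_posPart _)))
      convert h3 using 1
      module
    refine sub_nonneg.1 (h2.trans (sup_le ?_ ?_))
    · exact sub_le_sub_right le_sup_left _
    · exact sub_le_sub_right le_sup_right _
  have h4 := hmono h1
  rw [hsup] at h4
  have h5 := h4.trans (sup_le hx hy)
  simp only [s, t] at h5
  linarith

theorem real_latticeHom_additive {e : E} (G : E → ℝ)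
    (hsup : ∀ x y : E, G (x ⊔ y) = G x ⊔ G y) (hinf : ∀ x y : E, G (x ⊓ y) = G x ⊓ G y)
    (hGe : ∀ c : ℝ, G (c • e) = c) (he : 0 ≤ e) (x y : E) : G (x + y) = G x + G y := by
  refine le_antisymm (real_latticeHom_subadditive G hsup hinf hGe he x y) ?_
  have h := real_latticeHom_subadditive (e := e) (fun x => -G (-x))
    (fun x y => by simp only [neg_sup, hinf, neg_inf])
    (fun x y => by simp only [neg_inf, hsup, neg_sup])
    (fun c => by simp only [← neg_smul, hGe, neg_neg]) he (-x) (-y)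
  simp only [neg_add_rev, neg_neg] at h
  rw [add_comm y x] at h
  linarith

/-- A monotone additive map into an Archimedean Riesz space is real homogeneous. -/
theorem map_smul_of_monotone_of_map_add {F : Type*} [AddCommGroup F] [Lattice F]
    [IsOrderedAddMonoid F] [Module ℝ F] [PosSMulMono ℝ F]
    (hArch : ∀ x y : F, (∀ n : ℕ, n • x ≤ y) → x ≤ 0) (T : E →+ F) (hT : Monotone T)
    (c : ℝ) (x : E) : T (c • x) = c • T x := by
  have pos : ∀ (c : ℝ) (x : E), 0 ≤ x → T (c • x) = c • T x := by
    intro c x hx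
    have hTx : 0 ≤ T x := by simpa using hT hx
    have bounds : ∀ n : ℕ, n • (T (c • x) - c • T x) ≤ T x ∧
        n • (c • T x - T (c • x)) ≤ T x := by
      intro n
      have e1 : n • T (c • x) = T ((n * c : ℝ) • x) := by
        rw [← map_nsmul, ← Nat.cast_smul_eq_nsmul ℝ, smul_smul]
      have e2 : n • c • T x = (n * c : ℝ) • T x := by
        rw [← Nat.cast_smul_eq_nsmul ℝ, smul_smul]
      have e3 : ∀ k : ℤ, T ((k : ℝ) • x) = (k : ℝ) • T x := fun k => by
        rw [Int.cast_smul_eq_zsmul, Int.cast_smul_eq_zsmul, map_zsmul]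
      have l := Int.floor_le (n * c : ℝ)
      have u := (Int.lt_floor_add_one (n * c : ℝ)).le
      set k := ⌊(n * c : ℝ)⌋
      have a1 := hT (smul_le_smul_of_nonneg_right l hx)
      have a2 := hT (smul_le_smul_of_nonneg_right u hx)
      have b1 := smul_le_smul_of_nonneg_right l hTx
      have b2 := smul_le_smul_of_nonneg_right u hTx
      rw [add_smul, one_smul, map_add] at a2
      rw [e3] at a1 a2
      rw [add_smul, one_smul] at b2
      rw [nsmul_sub, nsmul_sub, e1, e2, sub_le_iff_le_add', sub_le_iff_le_add']
      exact ⟨a2.trans (add_le_add_left b1 _), b2.trans (add_le_add_left a1 _)⟩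
    exact le_antisymm (sub_nonpos.1 (hArch _ _ fun n => (bounds n).1))
      (sub_nonpos.1 (hArch _ _ fun n => (bounds n).2))
  rw [← posPart_sub_negPart x, smul_sub, map_sub, map_sub, smul_sub,
    pos c _ (posPart_nonneg x), pos c _ (negPart_nonneg x)]

end RieszSpace


/-- Let `E` be an Archimedean Riesz space with a strong order unit `e`,
let `F` be an Archimedean Riesz space, and let `T : E → F` be a lattice homomorphism
(not assumed linear) such that `T (c • e) = c • T e` for every real `c`.  Then `T` is
linear, hence a Riesz homomorphism. -/
theorem lattice_hom_strong_unit_is_linear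
    {E F : Type*}
    [AddCommGroup E] [Lattice E] [CovariantClass E E (· + ·) (· ≤ ·)]
    [Module ℝ E] [PosSMulMono ℝ E]
    [AddCommGroup F] [Lattice F] [CovariantClass F F (· + ·) (· ≤ ·)]
    [Module ℝ F] [PosSMulMono ℝ F]
    (hArchE : ∀ x y : E, (∀ n : ℕ, n • x ≤ y) → x ≤ 0)
    (hArchF : ∀ x y : F, (∀ n : ℕ, n • x ≤ y) → x ≤ 0)
    (e : E) (he : 0 ≤ e)
    (hunit : ∀ x : E, ∃ c : ℝ, 0 ≤ c ∧ |x| ≤ c • e)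
    (T : E → F)
    (hTsup : ∀ x y : E, T (x ⊔ y) = T x ⊔ T y)
    (hTinf : ∀ x y : E, T (x ⊓ y) = T x ⊓ T y)
    (hTe : ∀ c : ℝ, T (c • e) = c • T e) :
    (∀ x y : E, T (x + y) = T x + T y) ∧ (∀ (c : ℝ) (x : E), T (c • x) = c • T x) := by
  have : IsOrderedAddMonoid E := ⟨fun a b h c => by
    rw [add_comm a, add_comm b]; exact CovariantClass.elim c h, fun a b h c => CovariantClass.elim c h⟩
  have : IsOrderedAddMonoid F := ⟨fun a b h c => by
    rw [add_comm a, add_comm b]; exact CovariantClass.elim c h, fun a b h c => CovariantClass.elim c h⟩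
  have hmono : Monotone T := fun u v huv => by
    rw [← sup_eq_right.2 huv, hTsup]
    exact le_sup_left
  have ha : 0 ≤ T e := by
    have h := hmono he
    rwa [← zero_smul ℝ e, hTe, zero_smul] at h
  have hb : ∀ x : E, ∃ c : ℝ, |T x| ≤ c • T e := by
    intro x
    obtain ⟨c, -, hc⟩ := hunit x
    refine ⟨c, abs_le'.2 ⟨?_, ?_⟩⟩
    · rw [← hTe]
      exact hmono ((le_abs_self x).trans hc)
    · rw [neg_le, ← neg_smul, ← hTe, neg_smul]
      exact hmono (neg_le.1 ((neg_le_abs x).trans hc))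
  have hbadd : ∀ {u v : F}, (∃ c : ℝ, |u| ≤ c • T e) → (∃ c : ℝ, |v| ≤ c • T e) →
      ∃ c : ℝ, |u + v| ≤ c • T e := by
    rintro u v ⟨c, hc⟩ ⟨d, hd⟩
    refine ⟨c + d, (abs_add_le u v).trans ?_⟩
    rw [add_smul]
    exact add_le_add hc hd
  have hbneg : ∀ {u : F}, (∃ c : ℝ, |u| ≤ c • T e) → ∃ c : ℝ, |-u| ≤ c • T e := by
    simp
  have hcomp : ∀ φ : F → ℝ, (∀ c : ℝ, φ (c • T e) = c) →
      (∀ u v : F, (∃ c : ℝ, |u| ≤ c • T e) → (∃ c : ℝ, |v| ≤ c • T e) →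
        φ (u + v) = φ u + φ v ∧ φ (u ⊔ v) = φ u ⊔ φ v) →
      ∀ x y : E, φ (T (x + y)) = φ (T x + T y) := by
    intro φ hφe hφ x y
    rw [(hφ _ _ (hb x) (hb y)).1]
    refine real_latticeHom_additive (e := e) (fun x => φ (T x)) (fun x y => ?_) (fun x y => ?_)
      (fun c => ?_) he x y
    · simp only [hTsup, (hφ _ _ (hb x) (hb y)).2]
    · have h1 := (hφ _ _ (hb (x ⊓ y)) (hb (x ⊔ y))).1
      rw [hTinf, hTsup, inf_add_sup, (hφ _ _ (hb x) (hb y)).1, (hφ _ _ (hb x) (hb y)).2] at h1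
      have h2 := inf_add_sup (φ (T x)) (φ (T y))
      simp only [hTinf]
      linarith
    · simp only [hTe, hφe]
  have hle : ∀ u v : F, (∃ c : ℝ, |u| ≤ c • T e) → (∃ c : ℝ, |v| ≤ c • T e) →
      (∀ φ : F → ℝ, (∀ c : ℝ, φ (c • T e) = c) →
        (∀ u v : F, (∃ c : ℝ, |u| ≤ c • T e) → (∃ c : ℝ, |v| ≤ c • T e) →
          φ (u + v) = φ u + φ v ∧ φ (u ⊔ v) = φ u ⊔ φ v) → φ u = φ v) → u ≤ v := by
    intro u v hu hv huv
    by_contra hcon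
    have hd : ∃ c : ℝ, |u - v| ≤ c • T e := by
      rw [sub_eq_add_neg]
      exact hbadd hu (hbneg hv)
    obtain ⟨φ, hpos, hφe, hφ⟩ := exists_real_hom_pos hArchF ha (v := u - v)
      (fun h => hcon (sub_nonpos.1 h)) (hd.imp fun c hc => (le_abs_self _).trans hc)
    have h := (hφ _ _ hd hv).1
    rw [sub_add_cancel, huv φ hφe hφ] at h
    linarith
  have hadd : ∀ x y : E, T (x + y) = T x + T y := fun x y =>
    le_antisymm
      (hle _ _ (hb _) (hbadd (hb x) (hb y)) fun φ hφe hφ => hcomp φ hφe hφ x y)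
      (hle _ _ (hbadd (hb x) (hb y)) (hb _) fun φ hφe hφ => (hcomp φ hφe hφ x y).symm)
  exact ⟨hadd, map_smul_of_monotone_of_map_add hArchF (AddMonoidHom.mk' T hadd) hmono⟩
end

section
/- Let E and F be Archimedean Riesz spaces and let T : E → F be a lattice homomorphism (a map, not assumed additive, satisfying T(x ⊔ y) = T(x) ⊔ T(y) and T(x ⊓ y) = T(x) ⊓ T(y)) such that T(λ·x) = λ·T(x) for every λ ∈ ℝ and every x ∈ E. Then T is linear, i.e. T(x + y) = T(x) + T(y) for all x, y ∈ E; hence T is a Riesz homomorphism. -/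
section RieszSpace

variable {E F : Type*}
  [AddCommGroup E] [Lattice E] [IsOrderedAddMonoid E] [Module ℝ E] [PosSMulMono ℝ E]
  [AddCommGroup F] [Lattice F] [IsOrderedAddMonoid F] [Module ℝ F] [PosSMulMono ℝ F]

/-- An element that is disjoint from `p` and `q` and dominated by a multiple of `p + q` is zero. -/
lemma nonpos_of_le_smul_add_of_inf_nonpos {e p q : F} {M : ℝ} (hM : 1 ≤ M) (he : 0 ≤ e)
    (hp : e ⊓ p ≤ 0) (hq : e ⊓ q ≤ 0) (hle : e ≤ M • (p + q)) (hp0 : 0 ≤ p) :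
    e ≤ 0 := by
  have hM0 : 0 < M := by linarith
  have h1 : M⁻¹ • e ≤ e := by
    simpa using smul_le_smul_of_nonneg_right (inv_le_one_of_one_le₀ hM) he
  have h2 : M⁻¹ • e ≤ p + q := by
    have := smul_le_smul_of_nonneg_left hle (inv_nonneg.2 hM0.le)
    rwa [smul_smul, inv_mul_cancel₀ hM0.ne', one_smul] at this
  have h3 : M⁻¹ • e - p ≤ 0 :=
    (le_inf ((sub_le_self _ hp0).trans h1) (sub_le_iff_le_add'.2 h2)).trans hq
  have h4 : M⁻¹ • e ≤ 0 := (le_inf h1 (sub_nonpos.1 h3)).trans hp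
  have := smul_le_smul_of_nonneg_left h4 hM0.le
  rwa [smul_smul, mul_inv_cancel₀ hM0.ne', one_smul, smul_zero] at this

/-- A discrete intermediate value principle, in a Riesz space: in the totally ordered case it says
that if `v 0 ≥ 0`, then either `v n ≥ 0` or the sequence `v` changes sign at some step. -/
lemma nonpos_of_forall_le_smul_posPart_add_negPart {v : ℕ → F} {z : F} {M : ℝ} (hM : 1 ≤ M)
    {n : ℕ} (h0 : 0 ≤ v 0) (hstep : ∀ k < n, z ≤ M • ((v (k + 1))⁺ + (v k)⁻))
    (hlast : z ≤ M • (v n)⁻) : z ≤ 0 := by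
  have hM0 : 0 ≤ M := by linarith
  have key : ∀ k ≤ n, z⁺ ⊓ (v k)⁻ ≤ 0 := by
    intro k
    induction k with
    | zero => intro _; rw [negPart_eq_zero.2 h0]; exact inf_le_right
    | succ k ih =>
      intro hk
      refine nonpos_of_le_smul_add_of_inf_nonpos (p := (v (k + 1))⁺) (q := (v k)⁻) hM
        (le_inf (posPart_nonneg _) (negPart_nonneg _)) ?_ ?_ ?_
        (posPart_nonneg _)
      · rw [← posPart_inf_negPart_eq_zero (v (k + 1))]
        exact le_inf inf_le_right (inf_le_left.trans inf_le_right)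
      · exact (inf_le_inf_right _ inf_le_left).trans (ih (by omega))
      · exact inf_le_left.trans (sup_le (hstep k (by omega))
          (smul_nonneg hM0 (add_nonneg (posPart_nonneg _) (negPart_nonneg _))))
  refine (le_posPart z).trans ?_
  refine nonpos_of_le_smul_add_of_inf_nonpos (p := 0) (q := (v n)⁻) hM (posPart_nonneg _)
    inf_le_right (key n le_rfl) ?_ le_rfl
  rw [zero_add]
  exact sup_le hlast (smul_nonneg hM0 (negPart_nonneg _))

variable {T : E → F}

/-- An approximate form of subadditivity for homogeneous lattice homomorphisms. -/
lemma map_le_smul_map_add_smul_posPart (hTsup : ∀ x y : E, T (x ⊔ y) = T x ⊔ T y)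
    (hThom : ∀ (c : ℝ) (x : E), T (c • x) = c • T x)
    {a b : E} (hb : 0 ≤ T b) {s : ℝ} (hs : 0 < s) :
    T a ≤ (1 + s) • T b + ((1 + s) / s) • (T (a - b))⁺ := by
  have hmono : Monotone T := fun x y h ↦ by
    rw [← sup_eq_right, ← hTsup, sup_eq_right.2 h]
  have h1 : (0 : ℝ) < 1 + s := by linarith
  have hc : a ≤ ((1 + s) • b) ⊔ (((1 + s) / s) • (a - b)) := by
    have e : a = (1 / (1 + s)) • ((1 + s) • b) + (s / (1 + s)) • (((1 + s) / s) • (a - b)) := by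
      match_scalars <;> field_simp <;> ring
    calc a = _ := e
      _ ≤ (1 / (1 + s)) • (((1 + s) • b) ⊔ (((1 + s) / s) • (a - b))) +
          (s / (1 + s)) • (((1 + s) • b) ⊔ (((1 + s) / s) • (a - b))) :=
        add_le_add (smul_le_smul_of_nonneg_left le_sup_left (by positivity))
          (smul_le_smul_of_nonneg_left le_sup_right (by positivity))
      _ = _ := by
        rw [← add_smul, ← add_div, div_self h1.ne', one_smul]
  have h2 := hmono hc
  rw [hTsup, hThom, hThom] at h2
  refine h2.trans (sup_le ?_ ?_)
  · exact le_add_of_nonneg_right (smul_nonneg (by positivity) (posPart_nonneg _))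
  · exact le_add_of_nonneg_of_le (smul_nonneg h1.le hb)
      (smul_le_smul_of_nonneg_left (le_posPart _) (by positivity))

/-- A homogeneous lattice homomorphism into an Archimedean Riesz space is additive on the positive
cone. -/
lemma map_add_of_nonneg_of_homogeneous
    (hArch : ∀ x y : F, (∀ n : ℕ, n • x ≤ y) → x ≤ 0)
    (hTsup : ∀ x y : E, T (x ⊔ y) = T x ⊔ T y)
    (hThom : ∀ (c : ℝ) (x : E), T (c • x) = c • T x)
    {x y : E} (hx : 0 ≤ x) (hy : 0 ≤ y) : T (x + y) = T x + T y := by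
  have hmono : Monotone T := fun x y h ↦ by
    rw [← sup_eq_right, ← hTsup, sup_eq_right.2 h]
  have hT0 : T 0 = 0 := by simpa using hThom 0 0
  have hTneg (x : E) : T (-x) = -T x := by simpa using hThom (-1) x
  have hpos {x : E} (h : 0 ≤ x) : 0 ≤ T x := hT0 ▸ hmono h
  set u := x + y with hu
  have hu0 : 0 ≤ u := add_nonneg hx hy
  have hTx := hpos hx
  have hTy := hpos hy
  have hTu := hpos hu0
  have hxu : T x ≤ T u := hmono (le_add_of_nonneg_right hy)
  have hv (n : ℕ) (k : ℕ) :
      (T (((k : ℝ) / n) • u - x))⁺ = (T (x - ((k : ℝ) / n) • u))⁻ := by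
    rw [← neg_sub, hTneg, posPart_neg]
  have hvn {n : ℕ} (hn : 0 < n) : (T (x - ((n : ℝ) / n) • u))⁻ = T y := by
    have hn' : (n : ℝ) ≠ 0 := by positivity
    rw [div_self hn', one_smul, hu, sub_add_cancel_left, hTneg, negPart_neg,
      posPart_of_nonneg hTy]
  have hM {n : ℕ} (hn : 0 < n) : (1 : ℝ) ≤ (1 + 1 / (n : ℝ)) / (1 / n) := by
    have hn' : (0 : ℝ) < n := by positivity
    rw [le_div_iff₀ (by positivity)]
    linarith
  apply le_antisymm
  · rw [← sub_nonpos]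
    refine hArch _ (T u + T x + T y) fun n ↦ ?_
    rcases Nat.eq_zero_or_pos n with rfl | hn
    · rw [zero_smul]; positivity
    have hn' : (0 : ℝ) < n := by positivity
    have hs : (0 : ℝ) < 1 / n := by positivity
    have main : (((n : ℝ) - 1) / n) • T u - (1 + 1 / (n : ℝ)) • (T x + T y) ≤ 0 := by
      refine nonpos_of_forall_le_smul_posPart_add_negPart
        (v := fun k ↦ T (x - ((k : ℝ) / n) • u)) (hM hn) (n := n) (by simpa using hTx) ?_ ?_
      · intro k hk
        have h1 := map_le_smul_map_add_smul_posPart (a := ((k : ℝ) / n) • u) hTsup hThom hTx hs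
        have h2 := map_le_smul_map_add_smul_posPart (a := (1 - ((k + 1 : ℕ) : ℝ) / n) • u)
          hTsup hThom hTy hs
        rw [hv, hThom] at h1
        rw [show (1 - ((k + 1 : ℕ) : ℝ) / n) • u - y = x - (((k + 1 : ℕ) : ℝ) / n) • u by
          rw [hu]; module, hThom] at h2
        have h3 := add_le_add h1 h2
        rw [← sub_nonpos] at h3 ⊢
        refine le_of_eq_of_le ?_ h3
        push_cast
        match_scalars <;> field_simp <;> ring
      · have h1 := map_le_smul_map_add_smul_posPart (a := ((n : ℝ) / n) • u) hTsup hThom hTx hs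
        rw [hv, hThom, div_self hn'.ne', one_smul, ← div_self hn'.ne'] at h1
        have h2 : 0 ≤ (1 / (n : ℝ)) • T u + (1 + 1 / (n : ℝ)) • T y :=
          add_nonneg (smul_nonneg hs.le hTu) (smul_nonneg (by positivity) hTy)
        have h3 := sub_nonpos.2 (le_add_of_le_of_nonneg h1 h2)
        rw [← sub_nonpos]
        refine le_of_eq_of_le ?_ h3
        match_scalars <;> field_simp
    have h4 := smul_le_smul_of_nonneg_left main hn'.le
    rw [smul_zero] at h4
    rw [← sub_nonpos, ← Nat.cast_smul_eq_nsmul ℝ]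
    refine le_of_eq_of_le ?_ h4
    match_scalars <;> field_simp <;> ring
  · rw [← sub_nonpos]
    refine hArch _ ((3 : ℝ) • T u) fun n ↦ ?_
    rcases Nat.eq_zero_or_pos n with rfl | hn
    · rw [zero_smul]; exact smul_nonneg (by norm_num) hTu
    have hn' : (0 : ℝ) < n := by positivity
    have hs : (0 : ℝ) < 1 / n := by positivity
    have main : T x + T y - ((1 + 1 / (n : ℝ)) * ((n + 1) / n)) • T u ≤ 0 := by
      refine nonpos_of_forall_le_smul_posPart_add_negPart
        (v := fun k ↦ T (x - ((k : ℝ) / n) • u)) (hM hn) (n := n) (by simpa using hTx) ?_ ?_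
      · intro k hk
        have hk' : (k : ℝ) ≤ n := by exact_mod_cast hk.le
        have h1 := map_le_smul_map_add_smul_posPart (a := x)
          (b := (((k + 1 : ℕ) : ℝ) / n) • u) hTsup hThom
          (hpos (smul_nonneg (by positivity) hu0)) hs
        have h2 := map_le_smul_map_add_smul_posPart (a := y)
          (b := (1 - (k : ℝ) / n) • u) hTsup hThom
          (hpos (smul_nonneg (sub_nonneg.2 ((div_le_one hn').2 hk')) hu0)) hs
        rw [hThom] at h1
        rw [show y - (1 - (k : ℝ) / n) • u = ((k : ℝ) / n) • u - x by
          rw [hu]; module, hThom, hv] at h2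
        have h3 := add_le_add h1 h2
        rw [← sub_nonpos] at h3 ⊢
        refine le_of_eq_of_le ?_ h3
        push_cast
        match_scalars <;> field_simp <;> ring
      · simp only [hvn hn]
        have h1 : T y ≤ ((1 + 1 / (n : ℝ)) / (1 / n)) • T y := by
          simpa using smul_le_smul_of_nonneg_right (hM hn) hTy
        have h2 : T u ≤ ((1 + 1 / (n : ℝ)) * ((n + 1) / n)) • T u := by
          have : (1 : ℝ) ≤ (1 + 1 / (n : ℝ)) * ((n + 1) / n) := by
            rw [add_div, div_self hn'.ne']
            nlinarith
          simpa using smul_le_smul_of_nonneg_right this hTu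
        refine le_trans ?_ h1
        rw [sub_le_iff_le_add, add_comm]
        exact add_le_add_right (hxu.trans h2) _
    have h4 := smul_le_smul_of_nonneg_left main hn'.le
    have h5 : (2 + 1 / (n : ℝ)) • T u ≤ (3 : ℝ) • T u := by
      refine smul_le_smul_of_nonneg_right ?_ hTu
      have : 1 / (n : ℝ) ≤ 1 := (div_le_one hn').2 (by exact_mod_cast hn)
      linarith
    rw [smul_zero] at h4
    refine le_trans ?_ h5
    rw [← sub_nonpos, ← Nat.cast_smul_eq_nsmul ℝ]
    refine le_of_eq_of_le ?_ h4
    match_scalars <;> field_simp <;> ring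

end RieszSpace


/-- Let `E` and `F` be Archimedean Riesz spaces and `T : E → F` a
lattice homomorphism (not assumed additive) that is real-homogeneous:
`T (c • x) = c • T x` for all `c : ℝ`, `x : E`.  Then `T` is additive, hence linear,
hence a Riesz homomorphism. -/
theorem homogeneous_lattice_hom_is_linear
    {E F : Type*}
    [AddCommGroup E] [Lattice E] [CovariantClass E E (· + ·) (· ≤ ·)]
    [Module ℝ E] [PosSMulMono ℝ E]
    [AddCommGroup F] [Lattice F] [CovariantClass F F (· + ·) (· ≤ ·)]
    [Module ℝ F] [PosSMulMono ℝ F]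
    (hArchE : ∀ x y : E, (∀ n : ℕ, n • x ≤ y) → x ≤ 0)
    (hArchF : ∀ x y : F, (∀ n : ℕ, n • x ≤ y) → x ≤ 0)
    (T : E → F)
    (hTsup : ∀ x y : E, T (x ⊔ y) = T x ⊔ T y)
    (hTinf : ∀ x y : E, T (x ⊓ y) = T x ⊓ T y)
    (hThom : ∀ (c : ℝ) (x : E), T (c • x) = c • T x) :
    ∀ x y : E, T (x + y) = T x + T y := by
  have : IsOrderedAddMonoid E :=
    { add_le_add_left := fun a b h c ↦ by
        rw [add_comm a, add_comm b]; exact CovariantClass.elim c h }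
  have : IsOrderedAddMonoid F :=
    { add_le_add_left := fun a b h c ↦ by
        rw [add_comm a, add_comm b]; exact CovariantClass.elim c h }
  have hadd {x y : E} (hx : 0 ≤ x) (hy : 0 ≤ y) : T (x + y) = T x + T y :=
    map_add_of_nonneg_of_homogeneous hArchF hTsup hThom hx hy
  have hT0 : T 0 = 0 := by simpa using hThom 0 0
  have hTneg (x : E) : T (-x) = -T x := by simpa using hThom (-1) x
  have hTpos (x : E) : T x⁺ = (T x)⁺ := by rw [posPart_def, hTsup, hT0, posPart_def]
  have hparts (x : E) : T x = T x⁺ - T x⁻ := by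
    rw [← posPart_neg x, hTpos, hTpos, hTneg, posPart_neg, posPart_sub_negPart]
  intro x y
  have hpn : (x + y)⁺ + (x⁻ + y⁻) = (x⁺ + y⁺) + (x + y)⁻ := by
    rw [← sub_eq_sub_iff_add_eq_add, posPart_sub_negPart, add_sub_add_comm,
      posPart_sub_negPart, posPart_sub_negPart]
  have h := congrArg T hpn
  have p := @posPart_nonneg E _ _
  have q := @negPart_nonneg E _ _
  rw [hadd (p _) (add_nonneg (q _) (q _)), hadd (q _) (q _),
    hadd (add_nonneg (p _) (p _)) (q _), hadd (p _) (p _),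
    ← sub_eq_sub_iff_add_eq_add] at h
  rw [hparts (x + y), hparts x, hparts y, h, add_sub_add_comm]
end

section
/- Let E and F be Archimedean Riesz spaces with weak order units e ∈ E and f ∈ F respectively (an element u ≥ 0 of a Riesz space is a weak order unit if y ≥ 0 and y ⊓ u = 0 imply y = 0). Let T : E → F be a lattice homomorphism (a map, not assumed linear, satisfying T(x ⊔ y) = T(x) ⊔ T(y) and T(x ⊓ y) = T(x) ⊓ T(y)) such that T(λ·e) = λ·f for every λ ∈ ℝ. Then T is linear, i.e. T(x + y) = T(x) + T(y) and T(c·x) = c·T(x) for all x, y ∈ E and c ∈ ℝ; hence T is a Riesz homomorphism. -/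
set_option linter.unusedSectionVars false

section PrimeCone

variable {V : Type*} [AddCommGroup V] [Lattice V] [AddLeftMono V] [Module ℝ V] [PosSMulMono ℝ V]

/-- A set that is the nonnegative cone of a total vector preorder on `V` whose associated quotient
map is a Riesz homomorphism onto a totally ordered vector space. -/
structure IsPrimeCone (C : Set V) : Prop where
  mem_of_nonneg : ∀ {x}, 0 ≤ x → x ∈ C
  add_mem : ∀ {x y}, x ∈ C → y ∈ C → x + y ∈ C
  smul_mem : ∀ {t : ℝ} {x}, 0 ≤ t → x ∈ C → t • x ∈ C
  inf_mem : ∀ {x y}, x ∈ C → y ∈ C → x ⊓ y ∈ C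
  mem_or_neg_mem : ∀ x, x ∈ C ∨ -x ∈ C

theorem nonpos_of_pos_smul_nonpos {k : ℝ} (hk : 0 < k) {x : V} (h : k • x ≤ 0) : x ≤ 0 := by
  have := smul_le_smul_of_nonneg_left h (inv_nonneg.2 hk.le)
  rwa [smul_smul, inv_mul_cancel₀ hk.ne', one_smul, smul_zero] at this

theorem smul_le_smul_of_le_of_nonneg {a b : ℝ} {x : V} (hab : a ≤ b) (hx : 0 ≤ x) :
    a • x ≤ b • x := by
  rw [← sub_nonneg, ← sub_smul]
  exact smul_nonneg (sub_nonneg.2 hab) hx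

/-- A nonzero `v ≥ 0` has a prime cone in which every element whose positive part dominates `v` is
strictly positive. -/
theorem exists_isPrimeCone {v : V} (hv : 0 ≤ v) (hv0 : v ≠ 0) :
    ∃ C : Set V, IsPrimeCone C ∧ ∀ t, v ≤ t ⊔ 0 → -t ∉ C := by
  let _ : DistribLattice V := AddCommGroup.toDistribLattice V
  obtain ⟨J, hJ, hIJ, hFJ⟩ := DistribLattice.prime_ideal_of_disjoint_filter_ideal
    (F := Order.PFilter.principal v) (I := Order.Ideal.principal (0 : V)) (by
      rw [Set.disjoint_left]
      intro a ha ha'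
      have h1 : v ≤ a := ha
      have h2 : a ≤ 0 := ha'
      exact hv0 (le_antisymm (h1.trans h2) hv))
  have hJ0 : (0 : V) ∈ J := hIJ (show (0 : V) ∈ Order.Ideal.principal (0 : V) from le_rfl)
  have hvJ : v ∉ J := fun h => Set.disjoint_left.1 hFJ (show v ≤ v from le_rfl) h
  have key : ∀ {p q r : V}, (∀ t : ℝ, 0 ≤ t → t • p ∈ J) → (∀ t : ℝ, 0 ≤ t → t • q ∈ J) →
      r ≤ p + q → ∀ t : ℝ, 0 ≤ t → t • r ∈ J := by
    intro p q r hp hq hr t ht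
    refine J.lower ?_ (J.sup_mem (hp (2 * t) (by positivity)) (hq (2 * t) (by positivity)))
    rw [← sub_nonpos]
    set m := t • r - ((2 * t) • p ⊔ (2 * t) • q)
    have h1 : m ≤ t • r - (2 * t) • p := sub_le_sub_left le_sup_left _
    have h2 : m ≤ t • r - (2 * t) • q := sub_le_sub_left le_sup_right _
    refine nonpos_of_pos_smul_nonpos (k := 2) (by norm_num) ?_
    calc (2 : ℝ) • m = m + m := two_smul _ _
      _ ≤ _ := add_le_add h1 h2
      _ = (2 * t) • (r - (p + q)) := by module
      _ ≤ 0 := smul_nonpos_of_nonneg_of_nonpos (by positivity) (sub_nonpos.2 hr)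
  refine ⟨{x | ∀ t : ℝ, 0 ≤ t → t • (-x ⊔ 0) ∈ J}, ⟨?_, ?_, ?_, ?_, ?_⟩, ?_⟩
  · intro x hx t _
    rw [sup_eq_right.2 (neg_nonpos.2 hx), smul_zero]
    exact hJ0
  · intro x y hx hy
    refine key hx hy (sup_le ?_ (add_nonneg le_sup_right le_sup_right))
    rw [neg_add]
    exact add_le_add le_sup_left le_sup_left
  · intro s x hs hx t ht
    refine J.lower ?_ (hx (t * s) (mul_nonneg ht hs))
    rw [mul_smul]
    refine smul_le_smul_of_nonneg_left (sup_le ?_ (smul_nonneg hs le_sup_right)) ht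
    rw [← smul_neg]
    exact smul_le_smul_of_nonneg_left le_sup_left hs
  · intro x y hx hy
    refine key hx hy (sup_le ?_ (add_nonneg le_sup_right le_sup_right))
    rw [neg_inf]
    exact sup_le (le_sup_left.trans (le_add_of_nonneg_right le_sup_right))
      (le_sup_left.trans (le_add_of_nonneg_left le_sup_right))
  · intro x
    by_contra! h
    simp only [Set.mem_ofPred_eq, not_forall, neg_neg] at h
    obtain ⟨⟨s, hs, hsJ⟩, t, ht, htJ⟩ := h
    have hpos : 0 < s + t + 1 := by positivity
    have hdisj : (-x ⊔ 0) ⊓ (x ⊔ 0) ≤ 0 := by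
      have : -x ⊓ x ≤ 0 := by
        refine nonpos_of_pos_smul_nonpos (k := 2) (by norm_num) ?_
        calc (2 : ℝ) • (-x ⊓ x) = (-x ⊓ x) + (-x ⊓ x) := two_smul _ _
          _ ≤ -x + x := add_le_add inf_le_left inf_le_right
          _ = 0 := neg_add_cancel x
      rw [← sup_inf_right]
      exact sup_le this le_rfl
    have hmem : (s + t + 1) • (-x ⊔ 0) ⊓ (s + t + 1) • (x ⊔ 0) ∈ J := by
      refine J.lower ?_ hJ0
      refine nonpos_of_pos_smul_nonpos (inv_pos.2 hpos) (le_trans (le_inf ?_ ?_) hdisj)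
      · refine (smul_le_smul_of_nonneg_left inf_le_left (inv_nonneg.2 hpos.le)).trans_eq ?_
        rw [smul_smul, inv_mul_cancel₀ hpos.ne', one_smul]
      · refine (smul_le_smul_of_nonneg_left inf_le_right (inv_nonneg.2 hpos.le)).trans_eq ?_
        rw [smul_smul, inv_mul_cancel₀ hpos.ne', one_smul]
    rcases hJ.mem_or_mem hmem with h | h
    · exact hsJ (J.lower (smul_le_smul_of_le_of_nonneg (by linarith) le_sup_right) h)
    · exact htJ (J.lower (smul_le_smul_of_le_of_nonneg (by linarith) le_sup_right) h)
  · intro t hvt ht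
    have := ht 1 zero_le_one
    rw [neg_neg, one_smul] at this
    exact hvJ (J.lower hvt this)

namespace IsPrimeCone

variable {C : Set V} (hC : IsPrimeCone C)
include hC

theorem mem_of_le {x y : V} (hx : x ∈ C) (hxy : x ≤ y) : y ∈ C := by
  simpa using hC.add_mem hx (hC.mem_of_nonneg (sub_nonneg.2 hxy))

theorem mem_or_mem_of_sup_mem {x y : V} (h : x ⊔ y ∈ C) : x ∈ C ∨ y ∈ C := by
  have aux : ∀ {x y : V}, x ⊔ y ∈ C → x - y ∈ C → x ∈ C := by
    intro x y h hxy
    have h1 := hC.add_mem h (hC.inf_mem hxy (hC.mem_of_nonneg le_rfl))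
    refine hC.mem_of_le h1 ?_
    rw [← le_sub_iff_add_le]
    refine sup_le ?_ ?_
    · exact le_sub_self_iff _ |>.2 inf_le_right
    · rw [le_sub_comm]; exact inf_le_left
  rcases hC.mem_or_neg_mem (x - y) with h1 | h1
  · exact Or.inl (aux h h1)
  · rw [neg_sub] at h1
    rw [sup_comm] at h
    exact Or.inr (aux h h1)

theorem nonneg_of_smul_mem {f : V} (hf : -f ∉ C) {r : ℝ} (h : r • f ∈ C) : 0 ≤ r := by
  by_contra! hr
  apply hf
  have := hC.smul_mem (t := -r⁻¹) (by simpa using hr.le) h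
  rwa [smul_smul, neg_mul, inv_mul_cancel₀ hr.ne, neg_one_smul] at this

theorem exists_approx {f v : V} {N : ℝ} (hf : -f ∉ C) (h1 : N • f - v ∈ C)
    (h2 : N • f + v ∈ C) {δ : ℝ} (hδ : 0 < δ) :
    ∃ α : ℝ, v - α • f ∈ C ∧ v - (α + δ) • f ∉ C := by
  set S : Set ℝ := {r | v - r • f ∈ C}
  have hne : S.Nonempty := ⟨-N, by
    change v - (-N) • f ∈ C
    convert h2 using 1; module⟩
  have hbdd : BddAbove S := ⟨N, fun r hr => by
    have := hC.add_mem h1 hr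
    rw [show N • f - v + (v - r • f) = (N - r) • f by module] at this
    exact sub_nonneg.1 (hC.nonneg_of_smul_mem hf this)⟩
  obtain ⟨r, hr, hlt⟩ := exists_lt_of_lt_csSup hne (sub_lt_self (sSup S) hδ)
  refine ⟨r, hr, fun h => ?_⟩
  have := le_csSup hbdd (show r + δ ∈ S from h)
  linarith

end IsPrimeCone

end PrimeCone

section LatticeHom

variable {E F : Type*}
  [AddCommGroup E] [Lattice E] [AddLeftMono E] [Module ℝ E] [PosSMulMono ℝ E]
  [AddCommGroup F] [Lattice F] [AddLeftMono F] [Module ℝ F] [PosSMulMono ℝ F]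

theorem inf_smul_add_le_sup {x a s : E} {K : ℝ} (hK : 0 ≤ K) :
    a ⊓ (K • (x - a) + s) ≤ x ⊔ s := by
  rw [← sub_nonpos]
  set m := a ⊓ (K • (x - a) + s) - x ⊔ s
  have h1 : m ≤ a - x := sub_le_sub inf_le_left le_sup_left
  have h2 : m ≤ K • (x - a) := by
    refine (sub_le_sub inf_le_right le_sup_right).trans_eq ?_
    abel
  refine nonpos_of_pos_smul_nonpos (k := 1 + K) (by positivity) ?_
  calc (1 + K) • m = K • m + m := by module
    _ ≤ K • (a - x) + K • (x - a) := add_le_add (smul_le_smul_of_nonneg_left h1 hK) h2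
    _ = 0 := by module

theorem half_smul_add_le_sup (x y : E) : (1 / 2 : ℝ) • (x + y) ≤ x ⊔ y := by
  rw [← sub_nonpos]
  refine nonpos_of_pos_smul_nonpos (k := 2) (by norm_num) ?_
  calc (2 : ℝ) • ((1 / 2 : ℝ) • (x + y) - x ⊔ y) = (x - x ⊔ y) + (y - x ⊔ y) := by module
    _ ≤ 0 := add_nonpos (sub_nonpos.2 le_sup_left) (sub_nonpos.2 le_sup_right)

theorem inf_le_half_smul_add (x y : E) : x ⊓ y ≤ (1 / 2 : ℝ) • (x + y) := by
  rw [← sub_nonpos]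
  refine nonpos_of_pos_smul_nonpos (k := 2) (by norm_num) ?_
  calc (2 : ℝ) • (x ⊓ y - (1 / 2 : ℝ) • (x + y)) = (x ⊓ y - x) + (x ⊓ y - y) := by module
    _ ≤ 0 := add_nonpos (sub_nonpos.2 inf_le_left) (sub_nonpos.2 inf_le_right)

/-- A lattice homomorphism, not assumed linear, that maps `c • e` to `c • f` for all real `c`. -/
structure IsUnitalLatticeHom (e : E) (f : F) (T : E → F) : Prop where
  map_sup : ∀ x y, T (x ⊔ y) = T x ⊔ T y
  map_inf : ∀ x y, T (x ⊓ y) = T x ⊓ T y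
  map_smul_unit : ∀ c : ℝ, T (c • e) = c • f

namespace IsUnitalLatticeHom

variable {e : E} {f : F} {T : E → F} (hT : IsUnitalLatticeHom e f T)
include hT

theorem monotone : Monotone T := fun x y h => by
  rw [← sup_eq_right, ← hT.map_sup, sup_eq_right.2 h]

theorem neg_comp_neg : IsUnitalLatticeHom e f (fun x => -T (-x)) where
  map_sup x y := by rw [neg_sup, hT.map_inf, neg_inf]
  map_inf x y := by rw [neg_inf, hT.map_sup, neg_sup]
  map_smul_unit c := by rw [← neg_smul, hT.map_smul_unit, neg_smul, neg_neg]

variable {C : Set F} (hC : IsPrimeCone C)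
include hC

theorem smul_sub_add_notMem (hf : -f ∉ C) {x : E} {a s K : ℝ} (hx : T x - a • f ∉ C)
    (hs : s < a) (hK : 0 ≤ K) : T (K • (x - a • e) + s • e) - a • f ∉ C := by
  intro h
  have h1 := hT.monotone (inf_smul_add_le_sup (x := x) (a := a • e) (s := s • e) hK)
  rw [hT.map_inf, hT.map_sup, hT.map_smul_unit, hT.map_smul_unit] at h1
  have h2 : (T x - a • f) ⊔ (s • f - a • f) ∈ C := by
    rw [← sup_sub]
    refine hC.mem_of_le (hC.inf_mem (hC.mem_of_nonneg le_rfl) h) ?_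
    refine le_trans ?_ (sub_le_sub_right h1 _)
    rw [inf_sub, sub_self]
  rcases hC.mem_or_mem_of_sup_mem h2 with h3 | h3
  · exact hx h3
  · rw [← sub_smul] at h3
    have := hC.nonneg_of_smul_mem hf h3
    linarith

/-- Seen from a prime cone, if `T x` is below the constant `a`, then `T` maps large multiples of
`x - (a + δ) • e` below any constant. -/
theorem exists_forall_smul_sub_notMem (he : 0 ≤ e) (hf : -f ∉ C) {x : E} {a δ : ℝ}
    (hx : T x - a • f ∉ C) (hδ : 0 < δ) (M : ℝ) :
    ∃ K₀ : ℝ, ∀ K, K₀ ≤ K → T (K • (x - (a + δ) • e)) - M • f ∉ C := by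
  refine ⟨(4 * (|a| + |M| + 1)) / δ, fun K hK h => ?_⟩
  have hKδ : 4 * (|a| + |M| + 1) ≤ K * δ := (div_le_iff₀ hδ).1 hK
  have hK0 : 0 ≤ K := le_trans (by positivity) hK
  have ha1 := le_abs_self a
  have ha2 := neg_abs_le a
  have hM2 := neg_abs_le M
  have haM := abs_nonneg a
  have hMM := abs_nonneg M
  have hg : T (K • ((a + δ / 2) • e - x)) - a • f ∈ C := by
    have h1 := hT.smul_sub_add_notMem hC hf hx (sub_one_lt a) hK0
    have h2 : a • e ≤ (K • (x - a • e) + (a - 1) • e) ⊔ (K • ((a + δ / 2) • e - x)) := by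
      refine le_trans ?_ (half_smul_add_le_sup _ _)
      rw [← sub_nonneg]
      have : (1 / 2 : ℝ) • (K • (x - a • e) + (a - 1) • e + K • ((a + δ / 2) • e - x)) - a • e
          = (K * δ / 4 - (a + 1) / 2) • e := by module
      rw [this]
      exact smul_nonneg (by linarith) he
    have h3 := hT.monotone h2
    rw [hT.map_smul_unit, hT.map_sup, ← sub_nonneg, sup_sub] at h3
    exact (hC.mem_or_mem_of_sup_mem (hC.mem_of_nonneg h3)).resolve_left h1
  have hle : T (K • ((a + δ / 2) • e - x)) ⊓ T (K • (x - (a + δ) • e)) ≤ (-(K * δ / 4)) • f := by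
    rw [← hT.map_inf, ← hT.map_smul_unit]
    refine hT.monotone ((inf_le_half_smul_add _ _).trans_eq ?_)
    module
  set m := min a M
  have hfC : f ∈ C := (hC.mem_or_neg_mem f).resolve_right hf
  have hmem : ∀ {r : ℝ} {y : F}, m ≤ r → y - r • f ∈ C → y - m • f ∈ C := by
    intro r y hr hy
    have := hC.add_mem hy (hC.smul_mem (sub_nonneg.2 hr) hfC)
    convert this using 1
    module
  have h4 := hC.inf_mem (hmem (min_le_left a M) hg) (hmem (min_le_right a M) h)
  rw [← inf_sub] at h4
  have h5 := hC.mem_of_le h4 (sub_le_sub_right hle _)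
  rw [← sub_smul] at h5
  have h6 := hC.nonneg_of_smul_mem hf h5
  have h7 : -(|a| + |M|) ≤ m := le_min (by linarith) (by linarith)
  linarith

theorem sub_map_add_mem (he : 0 ≤ e) (hf : -f ∉ C) {x y : E} {a b c : ℝ}
    (hx : T x - a • f ∉ C) (hy : T y - b • f ∉ C) (hc : a + b < c) :
    c • f - T (x + y) ∈ C := by
  by_contra hz
  set δ := (c - a - b) / 3
  have hδ : 0 < δ := by simp only [δ]; linarith
  have hz' : -T (- -(x + y)) - (-c) • f ∉ C := by
    rwa [neg_neg, neg_smul, sub_neg_eq_add, neg_add_eq_sub]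
  obtain ⟨K₁, h₁⟩ := hT.exists_forall_smul_sub_notMem hC he hf hx hδ 0
  obtain ⟨K₂, h₂⟩ := hT.exists_forall_smul_sub_notMem hC he hf hy hδ 0
  obtain ⟨K₃, h₃⟩ := hT.neg_comp_neg.exists_forall_smul_sub_notMem hC he hf hz' hδ 0
  set K := |K₁| + |K₂| + |K₃|
  have hk1 := le_abs_self K₁
  have hk2 := le_abs_self K₂
  have hk3 := le_abs_self K₃
  have hk1' := abs_nonneg K₁
  have hk2' := abs_nonneg K₂
  have hk3' := abs_nonneg K₃
  have g₁ := h₁ (2 * K) (by simp only [K]; linarith)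
  have g₂ := h₂ (2 * K) (by simp only [K]; linarith)
  have g₃ := h₃ K (by simp only [K]; linarith)
  simp only [zero_smul, sub_zero] at g₁ g₂ g₃
  have g₄ := (hC.mem_or_neg_mem _).resolve_right g₃
  have hle : -(K • (-(x + y) - (-c + δ) • e)) ≤
      (2 * K) • (x - (a + δ) • e) ⊔ (2 * K) • (y - (b + δ) • e) := by
    refine le_trans (le_of_eq ?_) (half_smul_add_le_sup _ _)
    have : c = a + b + 3 * δ := by simp only [δ]; ring
    rw [this]
    module
  have h5 := hC.mem_of_le g₄ (hT.monotone hle)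
  rw [hT.map_sup] at h5
  exact (hC.mem_or_mem_of_sup_mem h5).elim g₁ g₂

end IsUnitalLatticeHom

/-- In an Archimedean Riesz space with weak order unit `f`, an element that is not below `0` is
positive in some prime cone in which `f` is positive and `g` is bounded by a multiple of `f`. -/
theorem exists_isPrimeCone_of_not_nonpos
    (hArch : ∀ x y : F, (∀ n : ℕ, n • x ≤ y) → x ≤ 0)
    (hf : 0 ≤ f) (hfunit : ∀ y : F, 0 ≤ y → y ⊓ f = 0 → y = 0)
    {u g : F} (hu : ¬ u ≤ 0) (hg : 0 ≤ g) :
    ∃ C : Set F, IsPrimeCone C ∧ -u ∉ C ∧ -f ∉ C ∧ ∃ N : ℝ, N • f - g ∈ C := by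
  set w := (u ⊔ 0) ⊓ f
  have hw : 0 ≤ w := le_inf le_sup_right hf
  have hw0 : w ≠ 0 := fun h => hu (by
    have := hfunit _ le_sup_right h
    rw [← this]
    exact le_sup_left)
  obtain ⟨N, hN⟩ : ∃ N : ℕ, w ⊓ (((N : ℝ) • f - g) ⊔ 0) ≠ 0 := by
    by_contra! hall
    refine hw0 (le_antisymm (hArch w g fun N => ?_) hw)
    rcases Nat.eq_zero_or_pos N with rfl | hNpos
    · simpa using hg
    have hN1 : (1 : ℝ) ≤ N := by exact_mod_cast hNpos
    have hN0 : (0 : ℝ) < N := by linarith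
    set p := ((N : ℝ) • w - g) ⊔ 0
    have hp0 : 0 ≤ p := le_sup_right
    have h1 : (N : ℝ)⁻¹ • p ≤ w := by
      have : p ≤ (N : ℝ) • w := sup_le (sub_le_self _ hg) (smul_nonneg hN0.le hw)
      refine (smul_le_smul_of_nonneg_left this (inv_nonneg.2 hN0.le)).trans_eq ?_
      rw [smul_smul, inv_mul_cancel₀ hN0.ne', one_smul]
    have h2 : (N : ℝ)⁻¹ • p ≤ ((N : ℝ) • f - g) ⊔ 0 := by
      have h3 : (N : ℝ)⁻¹ • p ≤ p := by
        rw [← sub_nonneg, show p - (N : ℝ)⁻¹ • p = (1 - (N : ℝ)⁻¹) • p by module]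
        exact smul_nonneg (sub_nonneg.2 (inv_le_one_of_one_le₀ hN1)) hp0
      exact h3.trans (sup_le_sup_right
        (sub_le_sub_right (smul_le_smul_of_nonneg_left inf_le_right hN0.le) _) _)
    have h4 : p ≤ 0 :=
      nonpos_of_pos_smul_nonpos (inv_pos.2 hN0) ((le_inf h1 h2).trans_eq (hall N))
    rw [← Nat.cast_smul_eq_nsmul ℝ, ← sub_nonpos]
    exact le_sup_left.trans h4
  obtain ⟨C, hC, hCv⟩ := exists_isPrimeCone (le_inf hw le_sup_right) hN
  refine ⟨C, hC, hCv _ (inf_le_left.trans inf_le_left),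
    hCv _ ((inf_le_left.trans inf_le_right).trans le_sup_left), N, ?_⟩
  exact (hC.mem_or_neg_mem _).resolve_right (hCv _ inf_le_right)

namespace IsUnitalLatticeHom

variable {e : E} {f : F} {T : E → F}

theorem map_add_le (hT : IsUnitalLatticeHom e f T)
    (hArch : ∀ x y : F, (∀ n : ℕ, n • x ≤ y) → x ≤ 0) (he : 0 ≤ e)
    (hf : 0 ≤ f) (hfunit : ∀ y : F, 0 ≤ y → y ⊓ f = 0 → y = 0) (x y : E) :
    T (x + y) ≤ T x + T y := by
  rw [← sub_nonpos]
  refine hArch _ f fun n => ?_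
  rcases Nat.eq_zero_or_pos n with rfl | hn
  · simpa using hf
  have hn0 : (0 : ℝ) < n := by exact_mod_cast hn
  rw [← sub_nonpos, ← Nat.cast_smul_eq_nsmul ℝ]
  by_contra hu
  obtain ⟨C, hC, huC, hfC, N, hN⟩ := exists_isPrimeCone_of_not_nonpos hArch hf hfunit hu
    (add_nonneg (abs_nonneg (T x)) (abs_nonneg (T y)))
  have hbound : ∀ {v : F}, |v| ≤ |T x| + |T y| → N • f - v ∈ C ∧ N • f + v ∈ C := by
    intro v hv
    refine ⟨hC.mem_of_le hN (sub_le_sub_left ((le_abs_self v).trans hv) _), hC.mem_of_le hN ?_⟩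
    rw [sub_eq_add_neg]
    refine add_le_add_right (neg_le.1 ((neg_le_abs v).trans hv)) _
  have hx := hbound (le_add_of_nonneg_right (a := |T x|) (abs_nonneg (T y)))
  have hy := hbound (le_add_of_nonneg_left (a := |T y|) (abs_nonneg (T x)))
  set δ : ℝ := 1 / (3 * n)
  have hδ : 0 < δ := by positivity
  obtain ⟨α, hα, hα'⟩ := hC.exists_approx hfC hx.1 hx.2 hδ
  obtain ⟨β, hβ, hβ'⟩ := hC.exists_approx hfC hy.1 hy.2 hδ
  have hz := hT.sub_map_add_mem hC he hfC hα' hβ' (c := α + β + 3 * δ) (by linarith)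
  apply huC
  have hsum := hC.smul_mem hn0.le (hC.add_mem hz (hC.add_mem hα hβ))
  have hnδ : (n : ℝ) * (3 * δ) = 1 := by simp only [δ]; field_simp
  convert hsum using 1
  calc -((n : ℝ) • (T (x + y) - (T x + T y)) - f)
      = (1 : ℝ) • f - (n : ℝ) • (T (x + y) - (T x + T y)) := by module
    _ = ((n : ℝ) * (3 * δ)) • f - (n : ℝ) • (T (x + y) - (T x + T y)) := by rw [hnδ]
    _ = _ := by module

theorem map_add (hT : IsUnitalLatticeHom e f T)
    (hArch : ∀ x y : F, (∀ n : ℕ, n • x ≤ y) → x ≤ 0) (he : 0 ≤ e)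
    (hf : 0 ≤ f) (hfunit : ∀ y : F, 0 ≤ y → y ⊓ f = 0 → y = 0) (x y : E) :
    T (x + y) = T x + T y := by
  refine le_antisymm (hT.map_add_le hArch he hf hfunit x y) ?_
  have := hT.neg_comp_neg.map_add_le hArch he hf hfunit (-x) (-y)
  simp only [neg_neg, neg_add_rev] at this
  rw [← neg_add_rev, neg_le_neg_iff, add_comm y x] at this
  rwa [add_comm (T x)]

end IsUnitalLatticeHom

/-- A monotone additive map into an Archimedean Riesz space is real linear. -/
theorem map_real_smul_of_monotone (hArch : ∀ x y : F, (∀ n : ℕ, n • x ≤ y) → x ≤ 0)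
    (T : E →+ F) (hT : Monotone T) (c : ℝ) (x : E) : T (c • x) = c • T x := by
  have hTn : ∀ (n : ℕ) (y : E), T ((n : ℝ) • y) = (n : ℝ) • T y := fun n y => by
    rw [Nat.cast_smul_eq_nsmul, map_nsmul, Nat.cast_smul_eq_nsmul]
  have pos : ∀ {c : ℝ} {x : E}, 0 ≤ x → 0 ≤ c → T (c • x) = c • T x := by
    intro c x hx hc
    have hTx : 0 ≤ T x := by simpa using hT hx
    have upper : ∀ r : ℝ, 0 ≤ r → T (r • x) ≤ r • T x + T x := fun r hr =>
      calc T (r • x) ≤ T ((⌈r⌉₊ : ℝ) • x) := hT (smul_le_smul_of_le_of_nonneg (Nat.le_ceil r) hx)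
        _ = (⌈r⌉₊ : ℝ) • T x := hTn _ _
        _ ≤ (r + 1) • T x := smul_le_smul_of_le_of_nonneg (Nat.ceil_lt_add_one hr).le hTx
        _ = r • T x + T x := by module
    have lower : ∀ r : ℝ, 0 ≤ r → r • T x ≤ T (r • x) + T x := fun r hr =>
      calc r • T x ≤ ((⌊r⌋₊ : ℝ) + 1) • T x :=
            smul_le_smul_of_le_of_nonneg (Nat.lt_floor_add_one r).le hTx
        _ = T ((⌊r⌋₊ : ℝ) • x) + T x := by rw [hTn]; module
        _ ≤ T (r • x) + T x := add_le_add_left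
            (hT (smul_le_smul_of_le_of_nonneg (Nat.floor_le hr) hx)) _
    refine le_antisymm (sub_nonpos.1 (hArch _ (T x) fun n => ?_))
      (sub_nonpos.1 (hArch _ (T x) fun n => ?_))
    · have h := upper (n * c) (by positivity)
      rw [mul_smul, mul_smul, hTn, ← sub_le_iff_le_add', ← smul_sub] at h
      rwa [← Nat.cast_smul_eq_nsmul ℝ]
    · have h := lower (n * c) (by positivity)
      rw [mul_smul, mul_smul, hTn, ← sub_le_iff_le_add', ← smul_sub] at h
      rwa [← Nat.cast_smul_eq_nsmul ℝ]
  have nonneg : ∀ {c : ℝ} (x : E), 0 ≤ c → T (c • x) = c • T x := by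
    intro c x hc
    rw [← posPart_sub_negPart x, smul_sub, map_sub, map_sub, smul_sub,
      pos (posPart_nonneg x) hc, pos (negPart_nonneg x) hc]
  rcases le_total 0 c with hc | hc
  · exact nonneg x hc
  · have h := nonneg x (neg_nonneg.2 hc)
    rwa [neg_smul, neg_smul, map_neg, neg_inj] at h

end LatticeHom


/-- Let `E` and `F` be Archimedean Riesz spaces with weak order units
`e ∈ E` and `f ∈ F`, and let `T : E → F` be a lattice homomorphism (not assumed linear)
such that `T (c • e) = c • f` for every real `c`.  Then `T` is linear, hence a Riesz
homomorphism. -/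
theorem lattice_hom_weak_units_is_linear
    {E F : Type*}
    [AddCommGroup E] [Lattice E] [CovariantClass E E (· + ·) (· ≤ ·)]
    [Module ℝ E] [PosSMulMono ℝ E]
    [AddCommGroup F] [Lattice F] [CovariantClass F F (· + ·) (· ≤ ·)]
    [Module ℝ F] [PosSMulMono ℝ F]
    (hArchE : ∀ x y : E, (∀ n : ℕ, n • x ≤ y) → x ≤ 0)
    (hArchF : ∀ x y : F, (∀ n : ℕ, n • x ≤ y) → x ≤ 0)
    (e : E) (he : 0 ≤ e) (heunit : ∀ y : E, 0 ≤ y → y ⊓ e = 0 → y = 0)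
    (f : F) (hf : 0 ≤ f) (hfunit : ∀ y : F, 0 ≤ y → y ⊓ f = 0 → y = 0)
    (T : E → F)
    (hTsup : ∀ x y : E, T (x ⊔ y) = T x ⊔ T y)
    (hTinf : ∀ x y : E, T (x ⊓ y) = T x ⊓ T y)
    (hTe : ∀ c : ℝ, T (c • e) = c • f) :
    (∀ x y : E, T (x + y) = T x + T y) ∧ (∀ (c : ℝ) (x : E), T (c • x) = c • T x) := by
  have hT : IsUnitalLatticeHom e f T := ⟨hTsup, hTinf, hTe⟩
  have hadd := hT.map_add hArchF he hf hfunit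
  exact ⟨hadd, map_real_smul_of_monotone hArchF (AddMonoidHom.mk' T hadd) hT.monotone⟩
end

section
/- Let E and F be Archimedean Riesz spaces with weak order units e ∈ E and f ∈ F respectively, and let T : E → F be a lattice homomorphism such that T(λ·e) = λ·f for every λ ∈ ℝ. Then T is additive on the positive cone: T(x + y) = T(x) + T(y) for all x, y ∈ E with x ≥ 0 and y ≥ 0. -/
section RieszSpace

variable {F : Type*} [AddCommGroup F] [Lattice F]

theorem inf_eq_zero_of_le {v w p q : F} (hw : 0 ≤ w) (hq : 0 ≤ q) (hwv : w ≤ v) (hqp : q ≤ p)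
    (h : v ⊓ p = 0) : w ⊓ q = 0 :=
  le_antisymm ((inf_le_inf hwv hqp).trans h.le) (le_inf hw hq)

/-- A proper filter of strictly positive elements of a Riesz space. -/
structure IsPosFilter (U : Set F) : Prop where
  nonneg : ∀ u ∈ U, 0 ≤ u
  ne_zero : ∀ u ∈ U, u ≠ 0
  inf_mem : ∀ u ∈ U, ∀ v ∈ U, u ⊓ v ∈ U

theorem exists_maximal_isPosFilter {z : F} (hz : 0 ≤ z) (hz0 : z ≠ 0) :
    ∃ U : Set F, z ∈ U ∧ Maximal IsPosFilter U := by
  obtain ⟨U, hzU, hU⟩ := zorn_subset_nonempty {U : Set F | IsPosFilter U} (by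
    intro c hc hchain hne
    refine ⟨⋃₀ c, ⟨?_, ?_, ?_⟩, fun s hs => Set.subset_sUnion_of_mem hs⟩
    · rintro u ⟨s, hs, hu⟩
      exact (hc hs).nonneg u hu
    · rintro u ⟨s, hs, hu⟩
      exact (hc hs).ne_zero u hu
    · rintro u ⟨s, hs, hu⟩ v ⟨t, ht, hv⟩
      rcases hchain.total hs ht with h | h
      · exact ⟨t, ht, (hc ht).inf_mem u (h hu) v hv⟩
      · exact ⟨s, hs, (hc hs).inf_mem u hu v (h hv)⟩) {z}
    ⟨by rintro u rfl; exact hz, by rintro u rfl; exact hz0, by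
      rintro u rfl v rfl; simp⟩
  exact ⟨U, hzU rfl, hU⟩

theorem mem_or_exists_inf_eq_zero {U : Set F} (hU : Maximal IsPosFilter U) {u₀ w : F}
    (hu₀ : u₀ ∈ U) (hw : 0 ≤ w) : w ∈ U ∨ ∃ v ∈ U, v ⊓ w = 0 := by
  by_contra! h
  obtain ⟨hwU, hne⟩ := h
  have hle : U ≤ {x | 0 ≤ x ∧ ∃ u ∈ U, u ⊓ w ≤ x} := fun u hu =>
    ⟨hU.prop.nonneg u hu, u, hu, inf_le_left⟩
  refine hwU (hU.le_of_ge ⟨fun u hu => hu.1, ?_, ?_⟩ hle ⟨hw, u₀, hu₀, inf_le_right⟩)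
  · rintro _ ⟨-, u, hu, hx⟩ rfl
    exact hne u hu (le_antisymm hx (le_inf (hU.prop.nonneg u hu) hw))
  · rintro x ⟨hx, u, hu, hux⟩ y ⟨hy, v, hv, hvy⟩
    exact ⟨le_inf hx hy, u ⊓ v, hU.prop.inf_mem u hu v hv,
      le_inf ((inf_le_inf_right w inf_le_left).trans hux)
        ((inf_le_inf_right w inf_le_right).trans hvy)⟩

theorem nonpos_of_forall_le_smul [Module ℝ F] [PosSMulMono ℝ F]
    (hArch : ∀ x y : F, (∀ n : ℕ, n • x ≤ y) → x ≤ 0)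
    {f : F} (hf : 0 ≤ f) {u : F} (h : ∀ η : ℝ, 0 < η → u ≤ η • f) : u ≤ 0 := by
  refine hArch u f fun n => ?_
  rcases Nat.eq_zero_or_pos n with rfl | hn
  · simpa using hf
  · have hn' : (0 : ℝ) < n := Nat.cast_pos.2 hn
    have := smul_le_smul_of_nonneg_left (h (n : ℝ)⁻¹ (inv_pos.2 hn')) hn'.le
    rwa [smul_smul, mul_inv_cancel₀ hn'.ne', one_smul, Nat.cast_smul_eq_nsmul] at this

variable [AddLeftMono F]

theorem inf_add_eq_zero_of_inf_eq_zero {v p q : F} (hv : 0 ≤ v) (hp : 0 ≤ p) (hq : 0 ≤ q)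
    (h₁ : v ⊓ p = 0) (h₂ : v ⊓ q = 0) : v ⊓ (p + q) = 0 := by
  refine le_antisymm ?_ (le_inf hv (add_nonneg hp hq))
  have hmq : v ⊓ (p + q) - p ≤ q := sub_le_iff_le_add'.2 inf_le_right
  have hmv : v ⊓ (p + q) - p ≤ v := (sub_le_self _ hp).trans inf_le_left
  have hmp : v ⊓ (p + q) ≤ p := sub_nonpos.1 ((le_inf hmv hmq).trans h₂.le)
  exact (le_inf inf_le_left hmp).trans h₁.le

theorem le_of_forall_inf_nsmul_le (hArch : ∀ x y : F, (∀ n : ℕ, n • x ≤ y) → x ≤ 0)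
    {f : F} (hf : 0 ≤ f) (hfunit : ∀ y : F, 0 ≤ y → y ⊓ f = 0 → y = 0)
    {u v : F} (hu : 0 ≤ u) (h : ∀ n : ℕ, u ⊓ n • f ≤ v) : u ≤ v := by
  have hw : ∀ n : ℕ, (u - v)⁺ ≤ (u - n • f)⁺ := by
    intro n
    have h₁ : u - u ⊓ n • f = (u - n • f)⁺ := by
      rw [sub_inf, sub_self, sup_comm, posPart_def]
    rw [← h₁]
    exact sup_le (sub_le_sub_left (h n) u) (sub_nonneg.2 inf_le_left)
  have hg : ∀ n : ℕ, n • ((u - v)⁺ ⊓ f) ≤ u := by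
    intro n
    induction n with
    | zero => simpa using hu
    | succ n ih =>
      have h₁ : (u - v)⁺ ⊓ f ≤ u - n • ((u - v)⁺ ⊓ f) := by
        refine inf_le_left.trans ((hw n).trans (sup_le ?_ (sub_nonneg.2 ih)))
        exact sub_le_sub_left (nsmul_le_nsmul_right inf_le_right n) u
      rw [succ_nsmul]
      exact le_sub_iff_add_le'.1 h₁
  have h₀ := hfunit _ (posPart_nonneg (u - v))
    (le_antisymm (hArch _ _ hg) (le_inf (posPart_nonneg _) hf))
  exact sub_nonpos.1 (posPart_eq_zero.1 h₀)

/-- The nonnegative cone of a total preorder on a Riesz space which is compatible with the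
lattice operations and for which `f` is strictly positive. -/
structure IsPrimeCone_s11 [Module ℝ F] (f : F) (P : F → Prop) : Prop where
  nonneg : ∀ u, 0 ≤ u → P u
  add : ∀ u v, P u → P v → P (u + v)
  total : ∀ u, P u ∨ P (-u)
  neg_negPart : ∀ u, P u → P (-u⁻)
  unit : ∀ c : ℝ, P (c • f) → 0 ≤ c

variable [Module ℝ F] {f : F}

namespace IsPrimeCone_s11

variable {P : F → Prop}

theorem of_inf_le (hP : IsPrimeCone_s11 f P) {p q r : F} (h : p ⊓ q ≤ r) :
    P (r - p) ∨ P (r - q) := by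
  have key : ∀ p q : F, p ⊓ q ≤ r → P (q - p) → P (r - p) := by
    intro p q h hqp
    have h₁ := hP.neg_negPart _ hqp
    have h₂ := hP.add _ _ (hP.nonneg _ (sub_nonneg.2 h)) h₁
    have h₃ : -(q - p)⁻ = p ⊓ q - p := by
      rw [negPart_def, neg_sup, neg_neg, neg_zero, inf_sub, sub_self, inf_comm]
    rwa [h₃, sub_add_sub_cancel] at h₂
  rcases hP.total (q - p) with hqp | hqp
  · exact Or.inl (key p q h hqp)
  · exact Or.inr (key q p (inf_comm p q ▸ h) (by rwa [neg_sub] at hqp))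

theorem of_le_sup (hP : IsPrimeCone_s11 f P) {p q r : F} (h : r ≤ p ⊔ q) :
    P (p - r) ∨ P (q - r) := by
  have h' : -p ⊓ -q ≤ -r := by rw [← neg_sup]; exact neg_le_neg_iff.2 h
  rcases hP.of_inf_le h' with h | h
  · exact Or.inl (by convert h using 1; abel)
  · exact Or.inr (by convert h using 1; abel)

theorem exists_approx_s11 (hP : IsPrimeCone_s11 f P) {u : F} {K δ : ℝ} (hδ : 0 < δ)
    (hl : -(K • f) ≤ u) (hu : u ≤ K • f) :
    ∃ a : ℝ, P (u - a • f) ∧ P ((a + δ) • f - u) := by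
  by_contra! h
  have hall : ∀ n : ℕ, P (u - (-K + n * δ) • f) := by
    intro n
    induction n with
    | zero => exact hP.nonneg _ (by simpa [neg_le_iff_add_nonneg] using hl)
    | succ n ih =>
      rcases hP.total (u - (-K + n * δ + δ) • f) with h' | h'
      · convert h' using 3
        push_cast
        ring
      · rw [neg_sub] at h'
        exact absurd h' (h _ ih)
  obtain ⟨n, hn⟩ := exists_nat_gt (2 * K / δ)
  rw [div_lt_iff₀ hδ] at hn
  have h₁ := hP.unit (2 * K - n * δ) (by
    convert hP.add _ _ (hall n) (hP.nonneg _ (sub_nonneg.2 hu)) using 1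
    module)
  linarith

end IsPrimeCone_s11

variable [PosSMulMono ℝ F]

theorem inf_smul_ne_zero (hf : 0 ≤ f) (hfunit : ∀ y : F, 0 ≤ y → y ⊓ f = 0 → y = 0)
    {c : ℝ} (hc : 0 < c) {v : F} (hv : 0 ≤ v) (hv0 : v ≠ 0) : v ⊓ c • f ≠ 0 := by
  intro h
  refine hv0 (hfunit v hv ?_)
  have hd : 0 < min c 1 := lt_min hc one_pos
  have hvf : 0 ≤ v ⊓ f := le_inf hv hf
  have h₁ : min c 1 • (v ⊓ f) ≤ v := by
    have : 0 ≤ (1 - min c 1) • v := smul_nonneg (by simp) hv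
    rw [sub_smul, one_smul, sub_nonneg] at this
    exact (smul_le_smul_of_nonneg_left inf_le_left hd.le).trans this
  have h₂ : min c 1 • (v ⊓ f) ≤ c • f := by
    have : 0 ≤ (c - min c 1) • f := smul_nonneg (by simp) hf
    rw [sub_smul, sub_nonneg] at this
    exact (smul_le_smul_of_nonneg_left inf_le_right hd.le).trans this
  have h₃ : min c 1 • (v ⊓ f) = 0 :=
    le_antisymm ((le_inf h₁ h₂).trans h.le) (smul_nonneg hd.le hvf)
  exact (smul_eq_zero.1 h₃).resolve_left hd.ne'

theorem exists_isPrimeCone_s11 (hf : 0 ≤ f) (hfunit : ∀ y : F, 0 ≤ y → y ⊓ f = 0 → y = 0)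
    {g : F} (hg : ¬ g ≤ 0) : ∃ P : F → Prop, IsPrimeCone_s11 f P ∧ P g := by
  have hg0 : g⁺ ≠ 0 := fun h => hg (posPart_eq_zero.1 h)
  obtain ⟨U, hgU, hU⟩ := exists_maximal_isPosFilter (posPart_nonneg g) hg0
  refine ⟨fun u => ∃ v ∈ U, v ⊓ u⁻ = 0, ⟨?_, ?_, ?_, ?_, ?_⟩,
    ⟨g⁺, hgU, posPart_inf_negPart_eq_zero g⟩⟩
  · intro u hu
    exact ⟨g⁺, hgU, by rw [negPart_eq_zero.2 hu]; exact inf_eq_right.2 (posPart_nonneg g)⟩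
  · rintro u u' ⟨v, hv, h⟩ ⟨v', hv', h'⟩
    have hvv := hU.prop.inf_mem v hv v' hv'
    have hvv0 := hU.prop.nonneg _ hvv
    refine ⟨v ⊓ v', hvv, inf_eq_zero_of_le hvv0 (negPart_nonneg _) le_rfl ?_
      (inf_add_eq_zero_of_inf_eq_zero hvv0 (negPart_nonneg u) (negPart_nonneg u')
        (inf_eq_zero_of_le hvv0 (negPart_nonneg u) inf_le_left le_rfl h)
        (inf_eq_zero_of_le hvv0 (negPart_nonneg u') inf_le_right le_rfl h'))⟩
    rw [negPart_def]
    refine sup_le ?_ (add_nonneg (negPart_nonneg u) (negPart_nonneg u'))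
    rw [neg_add]
    exact add_le_add (neg_le_negPart u) (neg_le_negPart u')
  · intro u
    rcases mem_or_exists_inf_eq_zero hU hgU (negPart_nonneg u) with h | h
    · exact Or.inr ⟨u⁻, h, by rw [negPart_neg, inf_comm, posPart_inf_negPart_eq_zero]⟩
    · exact Or.inl h
  · rintro u ⟨v, hv, h⟩
    exact ⟨v, hv, by rwa [negPart_neg, posPart_eq_self.2 (negPart_nonneg u)]⟩
  · rintro c ⟨v, hv, h⟩
    by_contra! hc
    refine inf_smul_ne_zero hf hfunit (neg_pos.2 hc) (hU.prop.nonneg v hv)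
      (hU.prop.ne_zero v hv) ?_
    rwa [negPart_def, ← neg_smul, sup_eq_left.2 (smul_nonneg (neg_pos.2 hc).le hf)] at h

theorem inf_le_convex_combination {p q : ℝ} (hp : 0 ≤ p) (hq : 0 ≤ q) (hpq : p + q = 1)
    {x y z : F} (hz : z = p • x + q • y) : x ⊓ y ≤ z := by
  rw [hz]
  calc x ⊓ y = p • (x ⊓ y) + q • (x ⊓ y) := by rw [← add_smul, hpq, one_smul]
    _ ≤ _ := add_le_add (smul_le_smul_of_nonneg_left inf_le_left hp)
      (smul_le_smul_of_nonneg_left inf_le_right hq)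

theorem convex_combination_le_sup {p q : ℝ} (hp : 0 ≤ p) (hq : 0 ≤ q) (hpq : p + q = 1)
    {x y z : F} (hz : z = p • x + q • y) : z ≤ x ⊔ y := by
  rw [hz]
  calc p • x + q • y ≤ p • (x ⊔ y) + q • (x ⊔ y) :=
      add_le_add (smul_le_smul_of_nonneg_left le_sup_left hp)
        (smul_le_smul_of_nonneg_left le_sup_right hq)
    _ = x ⊔ y := by rw [← add_smul, hpq, one_smul]

end RieszSpace

theorem monotone_of_map_sup {E F : Type*} [Lattice E] [Lattice F] {T : E → F}
    (hTsup : ∀ x y : E, T (x ⊔ y) = T x ⊔ T y) : Monotone T := by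
  intro x y h
  rw [← sup_eq_right.2 h, hTsup]
  exact le_sup_left

section LatticeHom

variable {E F : Type*}
  [AddCommGroup E] [Lattice E] [AddLeftMono E] [Module ℝ E] [PosSMulMono ℝ E]
  [AddCommGroup F] [Lattice F] [AddLeftMono F] [Module ℝ F]
  {e : E} {f : F} {T : E → F} {P : F → Prop}

theorem IsPrimeCone_s11.le_map_affine (hP : IsPrimeCone_s11 f P) (he : 0 ≤ e)
    (hTsup : ∀ x y : E, T (x ⊔ y) = T x ⊔ T y)
    (hTinf : ∀ x y : E, T (x ⊓ y) = T x ⊓ T y)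
    (hTe : ∀ c : ℝ, T (c • e) = c • f)
    {x : E} {a α β K : ℝ} (hx : P (T x - a • f)) (hα : 0 < α) (hK : K < α * a + β) :
    P (T (α • x + β • e) - K • f) := by
  have hmono := monotone_of_map_sup hTsup
  obtain ⟨b, hKb, hba⟩ : ∃ b, (K - β) / α < b ∧ b < a :=
    exists_between (by rw [div_lt_iff₀ hα]; linarith)
  rw [div_lt_iff₀ hα] at hKb
  obtain ⟨c, hca, hcK⟩ : ∃ c, c < a ∧ c < K :=
    ⟨min a K - 1, by linarith [min_le_left a K], by linarith [min_le_right a K]⟩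
  obtain ⟨r, hr, hrα, hrg⟩ : ∃ r : ℝ, 0 < r ∧ r ≤ α ∧ r * (K + b - 2 * c) ≤ b * α - (K - β) := by
    have hD : 0 < |K + b - 2 * c| + 1 := by positivity
    have hg : 0 < b * α - (K - β) := by linarith
    refine ⟨min α ((b * α - (K - β)) / (|K + b - 2 * c| + 1)), lt_min hα (div_pos hg hD),
      min_le_left _ _, ?_⟩
    have h₀ : 0 ≤ min α ((b * α - (K - β)) / (|K + b - 2 * c| + 1)) :=
      (lt_min hα (div_pos hg hD)).le
    calc _ ≤ min α ((b * α - (K - β)) / (|K + b - 2 * c| + 1)) * (|K + b - 2 * c| + 1) :=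
          mul_le_mul_of_nonneg_left (by linarith [le_abs_self (K + b - 2 * c)]) h₀
      _ ≤ (b * α - (K - β)) / (|K + b - 2 * c| + 1) * (|K + b - 2 * c| + 1) :=
          mul_le_mul_of_nonneg_right (min_le_right _ _) hD.le
      _ = _ := div_mul_cancel₀ _ hD.ne'
  obtain ⟨m, hm, rfl⟩ : ∃ m : ℝ, 1 ≤ m ∧ α = r * m :=
    ⟨α / r, (one_le_div hr).2 hrα, by field_simp⟩
  have hm0 : 0 < m := by linarith
  -- push `x` away from `b • e`, staying above level `a`
  have hw : P (T (m • x - ((m - 1) * b) • e) - a • f) := by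
    have h₁ : x ≤ (m • x - ((m - 1) * b) • e) ⊔ b • e := by
      refine convex_combination_le_sup (p := m⁻¹) (q := 1 - m⁻¹) (inv_nonneg.2 hm0.le)
        (sub_nonneg.2 (inv_le_one_of_one_le₀ hm)) (by ring) ?_
      match_scalars <;> field_simp <;> ring
    have h₂ := hmono h₁
    rw [hTsup, hTe] at h₂
    rcases hP.of_le_sup h₂ with h | h
    · convert hP.add _ _ h hx using 1
      abel
    · have := hP.unit (b - a) (by convert hP.add _ _ h hx using 1; module)
      linarith
  -- its reflection in `c • e` lies below level `c`
  have hh : P (c • f - T ((2 * c) • e - (m • x - ((m - 1) * b) • e))) := by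
    have h₁ : (m • x - ((m - 1) * b) • e) ⊓ ((2 * c) • e - (m • x - ((m - 1) * b) • e))
        ≤ c • e := by
      refine inf_le_convex_combination (p := 1 / 2) (q := 1 / 2) (by norm_num) (by norm_num)
        (by norm_num) ?_
      module
    have h₂ := hmono h₁
    rw [hTinf, hTe] at h₂
    rcases hP.of_inf_le h₂ with h | h
    · have := hP.unit (c - a) (by convert hP.add _ _ h hw using 1; module)
      linarith
    · exact h
  -- reflecting back through `K • e` gives an element above level `K`
  have hu : P (T (((1 + r) * K) • e - r • ((2 * c) • e - (m • x - ((m - 1) * b) • e)))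
      - K • f) := by
    have h₁ : K • e ≤ (((1 + r) * K) • e - r • ((2 * c) • e - (m • x - ((m - 1) * b) • e)))
        ⊔ ((2 * c) • e - (m • x - ((m - 1) * b) • e)) := by
      refine convex_combination_le_sup (p := 1 / (1 + r)) (q := r / (1 + r)) (by positivity)
        (by positivity) (by field_simp) ?_
      match_scalars <;> field_simp <;> ring
    have h₂ := hmono h₁
    rw [hTsup, hTe] at h₂
    rcases hP.of_le_sup h₂ with h | h
    · exact h
    · have := hP.unit (c - K) (by convert hP.add _ _ h hh using 1; module)
      linarith
  have hle : ((1 + r) * K) • e - r • ((2 * c) • e - (m • x - ((m - 1) * b) • e))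
      ≤ (r * m) • x + β • e := by
    rw [← sub_nonneg]
    have : 0 ≤ (b * (r * m) - (K - β) - r * (K + b - 2 * c)) • e :=
      smul_nonneg (sub_nonneg.2 hrg) he
    convert this using 1
    module
  convert hP.add _ _ (hP.nonneg _ (sub_nonneg.2 (hmono hle))) hu using 1
  abel

variable [PosSMulMono ℝ F]

theorem map_add_map_le_of_bounded (hArchF : ∀ x y : F, (∀ n : ℕ, n • x ≤ y) → x ≤ 0)
    (he : 0 ≤ e) (hf : 0 ≤ f) (hfunit : ∀ y : F, 0 ≤ y → y ⊓ f = 0 → y = 0)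
    (hTsup : ∀ x y : E, T (x ⊔ y) = T x ⊔ T y)
    (hTinf : ∀ x y : E, T (x ⊓ y) = T x ⊓ T y)
    (hTe : ∀ c : ℝ, T (c • e) = c • f) {K : ℝ} {x y : E}
    (hxl : -(K • e) ≤ x) (hxu : x ≤ K • e) (hyl : -(K • e) ≤ y) (hyu : y ≤ K • e) :
    T x + T y ≤ T (x + y) := by
  have hmono := monotone_of_map_sup hTsup
  have hl : ∀ {x : E}, -(K • e) ≤ x → -(K • f) ≤ T x := by
    intro x h
    rw [← neg_smul] at h ⊢
    simpa only [hTe] using hmono h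
  have hu : ∀ {x : E}, x ≤ K • e → T x ≤ K • f := by
    intro x h
    simpa only [hTe] using hmono h
  rw [← sub_nonpos]
  refine nonpos_of_forall_le_smul hArchF hf fun η hη => ?_
  rw [← sub_nonpos]
  by_contra hg
  obtain ⟨P, hP, hPg⟩ := exists_isPrimeCone_s11 hf hfunit hg
  have hδ : 0 < η / 4 := by positivity
  obtain ⟨a, hax, hxa⟩ := hP.exists_approx_s11 hδ (hl hxl) (hu hxu)
  obtain ⟨b, hby, hyb⟩ := hP.exists_approx_s11 hδ (hl hyl) (hu hyu)
  have h₁ := hP.le_map_affine he hTsup hTinf hTe (α := 2) (β := b - a) (K := a + b - η / 4)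
    hax two_pos (by linarith)
  have h₂ := hP.le_map_affine he hTsup hTinf hTe (α := 2) (β := a - b) (K := a + b - η / 4)
    hby two_pos (by linarith)
  have h₃ : ((2 : ℝ) • x + (b - a) • e) ⊓ ((2 : ℝ) • y + (a - b) • e) ≤ x + y := by
    refine inf_le_convex_combination (p := 1 / 2) (q := 1 / 2) (by norm_num) (by norm_num)
      (by norm_num) ?_
    module
  have h₄ := hmono h₃
  rw [hTinf] at h₄
  have h₅ : P (T (x + y) - (a + b - η / 4) • f) := by
    rcases hP.of_inf_le h₄ with h | h
    · simpa only [sub_add_sub_cancel] using hP.add _ _ h h₁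
    · simpa only [sub_add_sub_cancel] using hP.add _ _ h h₂
  have := hP.unit (-(η / 4)) (by
    convert hP.add _ _ (hP.add _ _ hPg h₅) (hP.add _ _ hxa hyb) using 1
    module)
  linarith

theorem map_add_of_bounded (hArchF : ∀ x y : F, (∀ n : ℕ, n • x ≤ y) → x ≤ 0)
    (he : 0 ≤ e) (hf : 0 ≤ f) (hfunit : ∀ y : F, 0 ≤ y → y ⊓ f = 0 → y = 0)
    (hTsup : ∀ x y : E, T (x ⊔ y) = T x ⊔ T y)
    (hTinf : ∀ x y : E, T (x ⊓ y) = T x ⊓ T y)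
    (hTe : ∀ c : ℝ, T (c • e) = c • f) {K : ℝ} {x y : E}
    (hxl : -(K • e) ≤ x) (hxu : x ≤ K • e) (hyl : -(K • e) ≤ y) (hyu : y ≤ K • e) :
    T (x + y) = T x + T y := by
  refine le_antisymm ?_
    (map_add_map_le_of_bounded hArchF he hf hfunit hTsup hTinf hTe hxl hxu hyl hyu)
  have h := map_add_map_le_of_bounded (T := fun x => -T (-x)) (x := -x) (y := -y) hArchF he hf
    hfunit (fun x y => by rw [neg_sup, hTinf, neg_inf]) (fun x y => by rw [neg_inf, hTsup, neg_sup])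
    (fun c => by rw [← neg_smul, hTe, neg_smul, neg_neg])
    (neg_le_neg_iff.2 hxu) (neg_le.1 hxl) (neg_le_neg_iff.2 hyu) (neg_le.1 hyl)
  simp only [neg_neg, ← neg_add] at h
  exact neg_le_neg_iff.1 h

end LatticeHom

theorem add_inf_eq_inf_add_inf_inf {E : Type*} [AddCommGroup E] [Lattice E] [AddLeftMono E]
    {x y w : E} (hx : 0 ≤ x) (hy : 0 ≤ y) (hw : 0 ≤ w) :
    (x + y) ⊓ w = (x ⊓ w + y ⊓ w) ⊓ w := by
  refine le_antisymm (le_inf ?_ inf_le_right)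
    (inf_le_inf_right w (add_le_add inf_le_left inf_le_left))
  rw [inf_add, add_inf, add_inf]
  exact le_inf (le_inf inf_le_left (inf_le_right.trans (le_add_of_nonneg_left hx)))
    (le_inf (inf_le_right.trans (le_add_of_nonneg_right hy))
      (inf_le_right.trans (le_add_of_nonneg_left hw)))

/-- Let `E` and `F` be Archimedean Riesz spaces with weak order units
`e ∈ E` and `f ∈ F`, and let `T : E → F` be a lattice homomorphism with
`T (c • e) = c • f` for all real `c`.  Then `T` is additive on the positive cone. -/
theorem lattice_hom_weak_units_additive_on_positive_cone
    {E F : Type*}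
    [AddCommGroup E] [Lattice E] [CovariantClass E E (· + ·) (· ≤ ·)]
    [Module ℝ E] [PosSMulMono ℝ E]
    [AddCommGroup F] [Lattice F] [CovariantClass F F (· + ·) (· ≤ ·)]
    [Module ℝ F] [PosSMulMono ℝ F]
    (hArchE : ∀ x y : E, (∀ n : ℕ, n • x ≤ y) → x ≤ 0)
    (hArchF : ∀ x y : F, (∀ n : ℕ, n • x ≤ y) → x ≤ 0)
    (e : E) (he : 0 ≤ e) (heunit : ∀ y : E, 0 ≤ y → y ⊓ e = 0 → y = 0)
    (f : F) (hf : 0 ≤ f) (hfunit : ∀ y : F, 0 ≤ y → y ⊓ f = 0 → y = 0)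
    (T : E → F)
    (hTsup : ∀ x y : E, T (x ⊔ y) = T x ⊔ T y)
    (hTinf : ∀ x y : E, T (x ⊓ y) = T x ⊓ T y)
    (hTe : ∀ c : ℝ, T (c • e) = c • f) :
    ∀ x y : E, 0 ≤ x → 0 ≤ y → T (x + y) = T x + T y := by
  intro x y hx hy
  have hmono := monotone_of_map_sup hTsup
  have hT0 : T 0 = 0 := by simpa using hTe 0
  have hTnonneg : ∀ {x : E}, 0 ≤ x → 0 ≤ T x := fun h => hT0 ▸ hmono h
  have hTn : ∀ n : ℕ, T (n • e) = n • f := fun n => by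
    simpa only [Nat.cast_smul_eq_nsmul] using hTe n
  have hbdd : ∀ {x : E} (n : ℕ), 0 ≤ x →
      -((n : ℝ) • e) ≤ x ⊓ n • e ∧ x ⊓ n • e ≤ (n : ℝ) • e := by
    intro x n h
    rw [Nat.cast_smul_eq_nsmul]
    have hn : 0 ≤ n • e := nsmul_nonneg he n
    exact ⟨(neg_nonpos.2 hn).trans (le_inf h hn), inf_le_right⟩
  have key : ∀ n : ℕ, T (x + y) ⊓ n • f = (T x + T y) ⊓ n • f := by
    intro n
    rw [← hTn, ← hTinf, add_inf_eq_inf_add_inf_inf hx hy (nsmul_nonneg he n), hTinf,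
      map_add_of_bounded hArchF he hf hfunit hTsup hTinf hTe (hbdd n hx).1 (hbdd n hx).2
        (hbdd n hy).1 (hbdd n hy).2, hTinf, hTinf, hTn,
      ← add_inf_eq_inf_add_inf_inf (hTnonneg hx) (hTnonneg hy) (nsmul_nonneg hf n)]
  exact le_antisymm
    (le_of_forall_inf_nsmul_le hArchF hf hfunit (hTnonneg (add_nonneg hx hy))
      fun n => (key n).le.trans inf_le_left)
    (le_of_forall_inf_nsmul_le hArchF hf hfunit (add_nonneg (hTnonneg hx) (hTnonneg hy))
      fun n => (key n).ge.trans inf_le_left)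
end

section
/- Let E and F be Archimedean Riesz spaces with weak order units e ∈ E and f ∈ F respectively, and let T : E → F be a lattice homomorphism such that T(λ·e) = λ·f for every λ ∈ ℝ. Then T(−x) = −T(x) for every x ∈ E with x ≥ 0, and consequently T(x)⁻ = T(x⁻) for every x ∈ E, where z⁻ = (−z) ⊔ 0 denotes the negative part. -/
section OrderedGroup

variable {F : Type*} [AddCommGroup F] [Lattice F] [IsOrderedAddMonoid F]

theorem posPart_inf_add_posPart_inf_le {a b g : F} (hab : a ⊓ b ≤ 0) :
    (a ⊔ 0) ⊓ g + (b ⊔ 0) ⊓ g ≤ g := by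
  let : DistribLattice F := AddCommGroup.toDistribLattice F
  rw [← inf_add_sup]
  have hinf : (a ⊔ 0) ⊓ g ⊓ ((b ⊔ 0) ⊓ g) ≤ 0 := by
    refine (inf_le_inf inf_le_left inf_le_left).trans ?_
    rw [← sup_inf_right]
    exact sup_le hab le_rfl
  exact (add_le_add hinf (sup_le inf_le_right inf_le_right)).trans_eq (zero_add g)

theorem posPart_inf_nsmul_succ_le (a : F) {g : F} (hg : 0 ≤ g) (n : ℕ) :
    (a ⊔ 0) ⊓ ((n + 1) • g) ≤ (a ⊔ 0) ⊓ (n • g) + ((a - n • g) ⊔ 0) ⊓ g := by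
  have hn : 0 ≤ n • g := nsmul_nonneg hg n
  rw [add_inf, inf_add, inf_add]
  refine le_inf (le_inf ?_ ?_) (le_inf ?_ ?_)
  · exact inf_le_left.trans (le_add_of_nonneg_right le_sup_right)
  · refine inf_le_left.trans ?_
    rw [add_sup, add_sub_cancel, add_zero]
    exact sup_le_sup le_rfl hn
  · exact inf_le_left.trans (le_add_of_nonneg_right hg)
  · rw [succ_nsmul]
    exact inf_le_right

theorem posPart_inf_nsmul_le_sum (a : F) {g : F} (hg : 0 ≤ g) (n : ℕ) :
    (a ⊔ 0) ⊓ (n • g) ≤ ∑ k ∈ Finset.range n, ((a - k • g) ⊔ 0) ⊓ g := by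
  induction n with
  | zero => simp
  | succ n ih =>
    rw [Finset.sum_range_succ]
    exact (posPart_inf_nsmul_succ_le a hg n).trans (add_le_add ih le_rfl)

/-- If `a - k • g` and `b + (k - 1) • g` are never simultaneously positive, then `a + b` is
at most `2 • g`, up to truncation. -/
theorem inf_nsmul_add_inf_nsmul_le {a b g : F} (hg : 0 ≤ g)
    (h : ∀ k : ℤ, (a - k • g) ⊓ (b + (k - 1) • g) ≤ 0) (m : ℕ) :
    a ⊓ (m • g) + b ⊓ (m • g) ≤ 2 • g := by
  have ha := posPart_inf_nsmul_le_sum (a + m • g) hg (2 * m)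
  have hb := posPart_inf_nsmul_le_sum (b + ((m : ℤ) - 2) • g) hg (2 * m)
  rw [← Finset.sum_range_reflect] at hb
  have hsum : (∑ k ∈ Finset.range (2 * m), (((a + m • g) - k • g) ⊔ 0) ⊓ g) +
      ∑ k ∈ Finset.range (2 * m),
        (((b + ((m : ℤ) - 2) • g) - (2 * m - 1 - k) • g) ⊔ 0) ⊓ g ≤ (2 * m) • g := by
    rw [← Finset.sum_add_distrib]
    refine (Finset.sum_le_card_nsmul _ _ g fun k hk => ?_).trans_eq (by simp)
    refine posPart_inf_add_posPart_inf_le ?_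
    convert h (k - m) using 2
    · module
    · have hk' : k + 1 ≤ 2 * m := Finset.mem_range.mp hk
      rw [← natCast_zsmul, show ((2 * m - 1 - k : ℕ) : ℤ) = 2 * m - 1 - k by omega]
      module
  have ha' : a ⊓ (m • g) + m • g ≤ ((a + m • g) ⊔ 0) ⊓ ((2 * m) • g) := by
    rw [inf_add, two_mul, add_nsmul]
    exact inf_le_inf le_sup_left le_rfl
  have hb' : b ⊓ (m • g) + ((m : ℤ) - 2) • g ≤
      ((b + ((m : ℤ) - 2) • g) ⊔ 0) ⊓ ((2 * m) • g) := by
    rw [inf_add]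
    refine inf_le_inf le_sup_left ?_
    have : (2 * m) • g = m • g + ((m : ℤ) - 2) • g + 2 • g := by module
    rw [this]
    exact le_add_of_nonneg_right (nsmul_nonneg hg 2)
  have key := ((add_le_add ha' hb').trans (add_le_add ha hb)).trans hsum
  refine le_of_add_le_add_right (a := m • g + ((m : ℤ) - 2) • g) ?_
  convert key using 1 <;> module

theorem nsmul_inf_eq_zero {d c : F} (hd : 0 ≤ d) (hc : 0 ≤ c) (h : d ⊓ c = 0) (n : ℕ) :
    (n • d) ⊓ c = 0 := by
  induction n with
  | zero => simpa using hc
  | succ n ih =>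
    refine le_antisymm ?_ (le_inf (nsmul_nonneg hd _) hc)
    rw [succ_nsmul]
    have hstep : (n • d + d) ⊓ c ≤ (n • d) ⊓ c + d := by
      rw [inf_add]
      exact inf_le_inf le_rfl (le_add_of_nonneg_right hd)
    rw [ih, zero_add] at hstep
    exact (le_inf hstep inf_le_right).trans h.le

/-- In an Archimedean lattice-ordered group with weak unit `g`, each `q` is the supremum of the
truncations `q ⊓ n • g`. -/
theorem le_of_forall_inf_nsmul_le_s12 (hArch : ∀ x y : F, (∀ n : ℕ, n • x ≤ y) → x ≤ 0)
    {g : F} (hg : 0 ≤ g) (hunit : ∀ y : F, 0 ≤ y → y ⊓ g = 0 → y = 0) {q z : F}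
    (h : ∀ n : ℕ, q ⊓ (n • g) ≤ z) : q ≤ z := by
  let : DistribLattice F := AddCommGroup.toDistribLattice F
  have hd : 0 ≤ (q - z) ⊔ 0 := le_sup_right
  have hdisj (n : ℕ) : ((q - z) ⊔ 0) ⊓ ((n • g - z) ⊔ 0) = 0 := by
    rw [← sup_inf_right, ← inf_sub, sup_eq_right]
    exact sub_nonpos.mpr (h n)
  have hbound (n : ℕ) : n • (((q - z) ⊔ 0) ⊓ g) ≤ z ⊔ 0 := by
    have hle : n • (((q - z) ⊔ 0) ⊓ g) ≤
        (n • ((q - z) ⊔ 0)) ⊓ ((n • g - z) ⊔ 0) + (z ⊔ 0) := by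
      rw [inf_add]
      refine le_inf ?_ ?_
      · exact (nsmul_le_nsmul_right inf_le_left n).trans (le_add_of_nonneg_right le_sup_right)
      · refine (nsmul_le_nsmul_right inf_le_right n).trans ?_
        calc n • g = (n • g - z) + z := by abel
          _ ≤ _ := add_le_add le_sup_left le_sup_left
    rwa [nsmul_inf_eq_zero hd le_sup_right (hdisj n), zero_add] at hle
  have hzero := hunit _ hd (le_antisymm (hArch _ _ hbound) (le_inf hd hg))
  exact sub_nonpos.mp (hzero ▸ le_sup_left)

end OrderedGroup

theorem le_of_pos_smul_le_smul {E : Type*} [AddCommGroup E] [PartialOrder E] [Module ℝ E]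
    [PosSMulMono ℝ E] {c : ℝ} (hc : 0 < c) {x y : E}
    (h : c • x ≤ c • y) : x ≤ y := by
  simpa [smul_smul, hc.ne'] using smul_le_smul_of_nonneg_left h (inv_nonneg.mpr hc.le)

section LatticeHom

variable {E F : Type*}
  [AddCommGroup E] [Lattice E] [IsOrderedAddMonoid E] [Module ℝ E] [PosSMulMono ℝ E]
  [AddCommGroup F] [Lattice F] [IsOrderedAddMonoid F] [Module ℝ F] [PosSMulMono ℝ F]

theorem smul_le_smul_of_le_of_nonneg_s12 {a b : ℝ} (hab : a ≤ b) {e : E} (he : 0 ≤ e) :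
    a • e ≤ b • e := by
  rw [← sub_nonneg, ← sub_smul]
  exact smul_nonneg (sub_nonneg.mpr hab) he

theorem inf_smul_sub_smul_le {e : E} (he : 0 ≤ e) (x : E) {c k t : ℝ} (hk : 0 ≤ k)
    (hc : c - k * t ≤ t) : x ⊓ (c • e - k • x) ≤ t • e := by
  refine le_of_pos_smul_le_smul (c := k + 1) (by positivity) ?_
  calc (k + 1) • (x ⊓ (c • e - k • x))
      = k • (x ⊓ (c • e - k • x)) + x ⊓ (c • e - k • x) := by module
    _ ≤ k • x + (c • e - k • x) :=
        add_le_add (smul_le_smul_of_nonneg_left inf_le_left hk) inf_le_right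
    _ = c • e := by abel
    _ ≤ ((k + 1) * t) • e := smul_le_smul_of_le_of_nonneg_s12 (by linarith) he
    _ = (k + 1) • t • e := mul_smul _ _ _

theorem lattice_hom_sub_smul_inf_le {e : E} (he : 0 ≤ e) {f : F} (hf : 0 ≤ f)
    (hfunit : ∀ y : F, 0 ≤ y → y ⊓ f = 0 → y = 0) {T : E → F}
    (hTsup : ∀ x y : E, T (x ⊔ y) = T x ⊔ T y)
    (hTinf : ∀ x y : E, T (x ⊓ y) = T x ⊓ T y)
    (hTe : ∀ c : ℝ, T (c • e) = c • f) (x : E) (r : ℝ) {ε : ℝ} (hε : 0 < ε) :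
    (T x - r • f) ⊓ (T (-x) + (r - ε) • f) ≤ 0 := by
  let : DistribLattice F := AddCommGroup.toDistribLattice F
  have hTmono {x y : E} (hxy : x ≤ y) : T x ≤ T y := by
    rw [← sup_eq_right, ← hTsup, sup_eq_right.mpr hxy]
  have hr := abs_nonneg r
  have hr₁ := le_abs_self r
  have hr₂ := neg_abs_le r
  set N : ℝ := 1 + |r| + ε with hN
  set k : ℝ := 2 * (N + |r|) / ε with hk
  have hk0 : 0 ≤ k := by positivity
  have hkε : k * ε = 2 * (N + |r|) := by rw [hk]; field_simp
  set s : ℝ := r - ε / 2 with hs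
  set y : E := (N + k * s) • e - k • x with hy
  set z : E := (N - k * s) • e - k • (-x) with hz
  have hxy : T x ⊓ T y ≤ r • f := by
    rw [← hTinf, ← hTe]
    exact hTmono (inf_smul_sub_smul_le he x hk0 (by rw [hs]; linarith))
  have hxz : T (-x) ⊓ T z ≤ (ε - r) • f := by
    rw [← hTinf, ← hTe]
    exact hTmono (inf_smul_sub_smul_le he (-x) hk0 (by rw [hs]; linarith))
  have hyz : N • f ≤ T y ⊔ T z := by
    rw [← hTsup, ← hTe]
    refine hTmono (le_of_pos_smul_le_smul (c := 2) two_pos ?_)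
    calc (2 : ℝ) • N • e = y + z := by rw [hy, hz]; module
      _ ≤ y ⊔ z + y ⊔ z := add_le_add le_sup_left le_sup_right
      _ = (2 : ℝ) • (y ⊔ z) := (two_smul ℝ _).symm
  have hf_le : f ≤ (T y - r • f) ⊔ (T z + (r - ε) • f) := by
    calc f = N • f - (N - 1) • f := by module
      _ ≤ T y ⊔ T z - (N - 1) • f := sub_le_sub_right hyz _
      _ = (T y - (N - 1) • f) ⊔ (T z - (N - 1) • f) := sup_sub _ _ _
      _ ≤ _ := by
        refine sup_le_sup (sub_le_sub_left (smul_le_smul_of_le_of_nonneg_s12 ?_ hf) _) ?_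
        · linarith
        · rw [sub_eq_add_neg, ← neg_smul]
          exact add_le_add le_rfl (smul_le_smul_of_le_of_nonneg_s12 (by linarith) hf)
  have hA : (T x - r • f) ⊓ (T y - r • f) ≤ 0 := by
    rw [← inf_sub]
    exact sub_nonpos.mpr hxy
  have hB : (T (-x) + (r - ε) • f) ⊓ (T z + (r - ε) • f) ≤ 0 := by
    rw [← inf_add]
    calc _ ≤ (ε - r) • f + (r - ε) • f := add_le_add hxz le_rfl
      _ = 0 := by module
  have hAB : (T x - r • f) ⊓ (T (-x) + (r - ε) • f) ⊓ f ≤ 0 := by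
    refine (inf_le_inf le_rfl hf_le).trans ?_
    rw [inf_sup_left]
    exact sup_le ((inf_le_inf inf_le_left le_rfl).trans hA)
      ((inf_le_inf inf_le_right le_rfl).trans hB)
  have hzero := hfunit (((T x - r • f) ⊓ (T (-x) + (r - ε) • f)) ⊔ 0) le_sup_right (by
    rw [inf_sup_right, inf_eq_left.mpr hf]
    exact sup_eq_right.mpr hAB)
  exact hzero ▸ le_sup_left

theorem lattice_hom_add_map_neg_nonpos {e : E} (he : 0 ≤ e)
    (hArch : ∀ x y : F, (∀ n : ℕ, n • x ≤ y) → x ≤ 0) {f : F} (hf : 0 ≤ f)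
    (hfunit : ∀ y : F, 0 ≤ y → y ⊓ f = 0 → y = 0) {T : E → F}
    (hTsup : ∀ x y : E, T (x ⊔ y) = T x ⊔ T y)
    (hTinf : ∀ x y : E, T (x ⊓ y) = T x ⊓ T y)
    (hTe : ∀ c : ℝ, T (c • e) = c • f) (x : E) : T x + T (-x) ≤ 0 := by
  refine hArch _ (2 • f) fun j => ?_
  rcases Nat.eq_zero_or_pos j with rfl | hj
  · simpa using nsmul_nonneg hf 2
  have hj' : (0 : ℝ) < j := Nat.cast_pos.mpr hj
  set g : F := (j : ℝ)⁻¹ • f with hg_def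
  have hg : 0 ≤ g := smul_nonneg (inv_nonneg.mpr hj'.le) hf
  have hjg : j • g = f := by
    rw [← Nat.cast_smul_eq_nsmul ℝ, hg_def, smul_smul, mul_inv_cancel₀ hj'.ne', one_smul]
  have htrunc (m : ℕ) : T x ⊓ (m • f) + T (-x) ⊓ (m • f) ≤ 2 • g := by
    rw [← hjg, ← mul_nsmul]
    refine inf_nsmul_add_inf_nsmul_le hg (fun k => ?_) _
    convert lattice_hom_sub_smul_inf_le he hf hfunit hTsup hTinf hTe x (k * (j : ℝ)⁻¹)
      (inv_pos.mpr hj') using 2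
    · rw [hg_def]; module
    · rw [hg_def]; module
  have hle (m : ℕ) : T (-x) ≤ 2 • g - T x ⊓ (m • f) := by
    refine le_of_forall_inf_nsmul_le_s12 hArch hf hfunit fun n => ?_
    rw [le_sub_iff_add_le']
    refine (add_le_add (inf_le_inf le_rfl ?_) (inf_le_inf le_rfl ?_)).trans (htrunc (max m n))
    · exact nsmul_le_nsmul_left hf (le_max_left m n)
    · exact nsmul_le_nsmul_left hf (le_max_right m n)
  have hsum : T x ≤ 2 • g - T (-x) :=
    le_of_forall_inf_nsmul_le_s12 hArch hf hfunit fun m => le_sub_comm.mp (hle m)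
  calc j • (T x + T (-x)) ≤ j • (2 • g) :=
        nsmul_le_nsmul_right (le_sub_iff_add_le.mp hsum) j
    _ = 2 • f := by rw [nsmul_left_comm, hjg]

theorem lattice_hom_map_neg {e : E} (he : 0 ≤ e)
    (hArch : ∀ x y : F, (∀ n : ℕ, n • x ≤ y) → x ≤ 0) {f : F} (hf : 0 ≤ f)
    (hfunit : ∀ y : F, 0 ≤ y → y ⊓ f = 0 → y = 0) {T : E → F}
    (hTsup : ∀ x y : E, T (x ⊔ y) = T x ⊔ T y)
    (hTinf : ∀ x y : E, T (x ⊓ y) = T x ⊓ T y)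
    (hTe : ∀ c : ℝ, T (c • e) = c • f) (x : E) : T (-x) = -T x := by
  have hle := lattice_hom_add_map_neg_nonpos he hArch hf hfunit hTsup hTinf hTe x
  have hge := lattice_hom_add_map_neg_nonpos (T := fun x => -T (-x)) he hArch hf hfunit
    (fun x y => by simp only [neg_sup, hTinf, neg_inf])
    (fun x y => by simp only [neg_inf, hTsup, neg_sup])
    (fun c => by simp only [← neg_smul, hTe, neg_neg]) x
  rw [neg_neg, ← neg_add, neg_nonpos, add_comm] at hge
  exact eq_neg_of_add_eq_zero_right (le_antisymm hle hge)

end LatticeHom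


/-- Let `E` and `F` be Archimedean Riesz spaces with weak order units
`e ∈ E` and `f ∈ F`, and let `T : E → F` be a lattice homomorphism with
`T (c • e) = c • f` for all real `c`.  Then `T (-x) = -T x` for every `x ≥ 0`, and
consequently `(T x)⁻ = T (x⁻)` for every `x`, where `z⁻ = (-z) ⊔ 0`. -/
theorem lattice_hom_weak_units_neg_and_negPart
    {E F : Type*}
    [AddCommGroup E] [Lattice E] [CovariantClass E E (· + ·) (· ≤ ·)]
    [Module ℝ E] [PosSMulMono ℝ E]
    [AddCommGroup F] [Lattice F] [CovariantClass F F (· + ·) (· ≤ ·)]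
    [Module ℝ F] [PosSMulMono ℝ F]
    (hArchE : ∀ x y : E, (∀ n : ℕ, n • x ≤ y) → x ≤ 0)
    (hArchF : ∀ x y : F, (∀ n : ℕ, n • x ≤ y) → x ≤ 0)
    (e : E) (he : 0 ≤ e) (heunit : ∀ y : E, 0 ≤ y → y ⊓ e = 0 → y = 0)
    (f : F) (hf : 0 ≤ f) (hfunit : ∀ y : F, 0 ≤ y → y ⊓ f = 0 → y = 0)
    (T : E → F)
    (hTsup : ∀ x y : E, T (x ⊔ y) = T x ⊔ T y)
    (hTinf : ∀ x y : E, T (x ⊓ y) = T x ⊓ T y)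
    (hTe : ∀ c : ℝ, T (c • e) = c • f) :
    (∀ x : E, 0 ≤ x → T (-x) = -T x) ∧
      (∀ x : E, (-(T x)) ⊔ 0 = T ((-x) ⊔ 0)) := by
  have : IsOrderedAddMonoid E :=
    { add_le_add_left := fun _ _ h c => add_le_add_left h c
      add_le_add_right := fun _ _ h c => add_le_add_right h c }
  have : IsOrderedAddMonoid F :=
    { add_le_add_left := fun _ _ h c => add_le_add_left h c
      add_le_add_right := fun _ _ h c => add_le_add_right h c }
  have hneg := lattice_hom_map_neg he hArchF hf hfunit hTsup hTinf hTe
  have hzero : T 0 = 0 := by simpa using hTe 0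
  exact ⟨fun x _ => hneg x, fun x => by rw [hTsup, hneg, hzero]⟩
end

section
/- Let X be a compact Hausdorff topological space, let E be a uniformly dense Riesz subspace of C(X,ℝ) containing the constant function 1, let F be an Archimedean Riesz space, and let T : E → F be a lattice homomorphism such that T(λ·1) = λ·T(1) for every λ ∈ ℝ. Then for every real-valued lattice homomorphism ψ : F → ℝ with ψ(λ·T(1)) = λ for all λ ∈ ℝ, there exists a unique point x ∈ X such that ψ(T(g)) = g(x) for all g ∈ E. -/
/-- A dense subset of `C(X, ℝ)` separates points with arbitrarily prescribed bounds. -/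
theorem exists_mem_lt_and_lt_of_dense {X : Type*} [TopologicalSpace X] [CompactSpace X]
    [T2Space X] {E : Set C(X, ℝ)} (hdense : Dense E) {x y : X} (hxy : x ≠ y) (c d : ℝ) :
    ∃ g ∈ E, g x < c ∧ d < g y := by
  obtain ⟨h, hx, hy, -⟩ := exists_continuous_zero_one_of_isClosed
    (isClosed_singleton (x := x)) (isClosed_singleton (x := y))
    (Set.disjoint_singleton.2 hxy)
  have hx : h x = 0 := hx rfl
  have hy : h y = 1 := hy rfl
  let k : C(X, ℝ) := ContinuousMap.const X (c - 1) + (d - c + 2) • h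
  obtain ⟨g, hg, hgE⟩ := hdense.inter_open_nonempty ({g | g x < c} ∩ {g | d < g y})
    ((isOpen_lt (continuous_eval_const x) continuous_const).inter
      (isOpen_lt continuous_const (continuous_eval_const y)))
    ⟨k, by simp [k, hx], by simp [k, hy]; linarith⟩
  exact ⟨g, hgE, hg⟩

/-- Kaplansky's argument: the prime ideal `{f | φ f < c}` of a sublattice of `C(X, ℝ)` is
associated with a point of `X`. -/
theorem exists_point_forall_lt_imp_lt {X : Type*} [TopologicalSpace X] [CompactSpace X]
    {E : Set C(X, ℝ)}
    (hsup : ∀ f g : C(X, ℝ), f ∈ E → g ∈ E → f ⊔ g ∈ E)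
    (hinf : ∀ f g : C(X, ℝ), f ∈ E → g ∈ E → f ⊓ g ∈ E)
    {φ : C(X, ℝ) → ℝ}
    (hφsup : ∀ f ∈ E, ∀ g ∈ E, φ (f ⊔ g) = max (φ f) (φ g))
    (hφinf : ∀ f ∈ E, ∀ g ∈ E, φ (f ⊓ g) = min (φ f) (φ g))
    {c : ℝ} (hlt : ∃ f ∈ E, φ f < c) (hle : ∃ g ∈ E, c ≤ φ g) :
    ∃ x : X, ∀ f ∈ E, ∀ g ∈ E, φ f < c → g x < f x → φ g < c := by
  by_contra! H
  obtain ⟨f, hf, g, hg, hfc, hgc, hgf⟩ : ∃ f ∈ E, ∃ g ∈ E, φ f < c ∧ c ≤ φ g ∧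
      ∀ x ∈ (Set.univ : Set X), g x ≤ f x := by
    refine isCompact_univ.induction_on
      (p := fun s => ∃ f ∈ E, ∃ g ∈ E, φ f < c ∧ c ≤ φ g ∧ ∀ x ∈ s, g x ≤ f x) ?_ ?_ ?_ ?_
    · obtain ⟨f, hf, hfc⟩ := hlt
      obtain ⟨g, hg, hgc⟩ := hle
      exact ⟨f, hf, g, hg, hfc, hgc, by simp⟩
    · rintro s t hst ⟨f, hf, g, hg, hfc, hgc, h⟩
      exact ⟨f, hf, g, hg, hfc, hgc, fun x hx => h x (hst hx)⟩
    · rintro s t ⟨f, hf, g, hg, hfc, hgc, h⟩ ⟨f', hf', g', hg', hfc', hgc', h'⟩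
      refine ⟨f ⊔ f', hsup _ _ hf hf', g ⊓ g', hinf _ _ hg hg', ?_, ?_, ?_⟩
      · rw [hφsup f hf f' hf']
        exact max_lt hfc hfc'
      · rw [hφinf g hg g' hg']
        exact le_min hgc hgc'
      · rintro x (hx | hx)
        · exact inf_le_left.trans ((h x hx).trans le_sup_left)
        · exact inf_le_right.trans ((h' x hx).trans le_sup_right)
    · intro x _
      obtain ⟨f, hf, g, hg, hfc, hgf, hgc⟩ := H x
      exact ⟨{y | g y < f y}, mem_nhdsWithin_of_mem_nhds
        ((isOpen_lt g.continuous f.continuous).mem_nhds hgf),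
        f, hf, g, hg, hfc, hgc, fun y hy => le_of_lt hy⟩
  have hfg : f ⊔ g = f := sup_eq_left.2 fun x => hgf x trivial
  have hle : φ g ≤ φ f := by
    rw [← hfg, hφsup f hf g hg]
    exact le_max_right _ _
  linarith

/-- A real-valued lattice homomorphism fixing the constants, on a dense sublattice of `C(X, ℝ)`
containing them, is a point evaluation. -/
theorem exists_forall_eq_eval_of_lattice_hom {X : Type*} [TopologicalSpace X] [CompactSpace X]
    [T2Space X] {E : Set C(X, ℝ)}
    (hsup : ∀ f g : C(X, ℝ), f ∈ E → g ∈ E → f ⊔ g ∈ E)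
    (hinf : ∀ f g : C(X, ℝ), f ∈ E → g ∈ E → f ⊓ g ∈ E)
    (hdense : Dense E) (hconst : ∀ c : ℝ, ContinuousMap.const X c ∈ E)
    {φ : C(X, ℝ) → ℝ}
    (hφsup : ∀ f ∈ E, ∀ g ∈ E, φ (f ⊔ g) = max (φ f) (φ g))
    (hφinf : ∀ f ∈ E, ∀ g ∈ E, φ (f ⊓ g) = min (φ f) (φ g))
    (hφconst : ∀ c : ℝ, φ (ContinuousMap.const X c) = c) :
    ∃ x : X, ∀ g ∈ E, φ g = g x := by
  have key (c : ℝ) : ∃ x : X, ∀ g ∈ E, (g x < c → φ g ≤ c) ∧ (c < g x → c ≤ φ g) := by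
    obtain ⟨x, hx⟩ := exists_point_forall_lt_imp_lt hsup hinf hφsup hφinf (c := c)
      ⟨_, hconst (c - 1), by rw [hφconst]; linarith⟩ ⟨_, hconst c, (hφconst c).ge⟩
    refine ⟨x, fun g hg => ⟨fun hgx => ?_, fun hgx => ?_⟩⟩
    · obtain ⟨b, hgb, hbc⟩ := exists_between hgx
      exact (hx _ (hconst b) g hg (by rwa [hφconst]) hgb).le
    · by_contra! hlt
      have := hx g hg _ (hconst c) hlt hgx
      rw [hφconst] at this
      exact this.false
  choose p hp using key
  have hp_lt {c d : ℝ} (hcd : c < d) : p c = p d := by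
    by_contra hne
    obtain ⟨g, hg, hgc, hgd⟩ := exists_mem_lt_and_lt_of_dense hdense hne c d
    have := (hp c g hg).1 hgc
    have := (hp d g hg).2 hgd
    linarith
  have hp_eq (c : ℝ) : p c = p 0 := by
    rcases lt_trichotomy c 0 with h | rfl | h
    · exact hp_lt h
    · rfl
    · exact (hp_lt h).symm
  simp only [hp_eq] at hp
  exact ⟨p 0, fun g hg => le_antisymm (le_of_forall_gt_imp_ge_of_dense fun c hc => (hp c g hg).1 hc)
    (le_of_forall_lt_imp_le_of_dense fun c hc => (hp c g hg).2 hc)⟩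


/-- Let `X` be a compact Hausdorff space, `E` a uniformly dense Riesz
subspace of `C(X, ℝ)` containing `1`, `F` an Archimedean Riesz space, and `T : E → F`
a lattice homomorphism with `T (c • 1) = c • T 1` for all real `c`.  Then for every
real-valued lattice homomorphism `ψ : F → ℝ` with `ψ (c • T 1) = c` for all real `c`,
there is a unique point `x ∈ X` with `ψ (T g) = g x` for all `g ∈ E`. -/
theorem composed_lattice_hom_is_point_evaluation
    {X : Type*} [TopologicalSpace X] [CompactSpace X] [T2Space X]
    {F : Type*}
    [AddCommGroup F] [Lattice F] [CovariantClass F F (· + ·) (· ≤ ·)]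
    [Module ℝ F] [PosSMulMono ℝ F]
    (hArchF : ∀ x y : F, (∀ n : ℕ, n • x ≤ y) → x ≤ 0)
    (E : Submodule ℝ C(X, ℝ))
    (hsup : ∀ f g : C(X, ℝ), f ∈ E → g ∈ E → f ⊔ g ∈ E)
    (hinf : ∀ f g : C(X, ℝ), f ∈ E → g ∈ E → f ⊓ g ∈ E)
    (hdense : Dense (E : Set C(X, ℝ)))
    (hone : (1 : C(X, ℝ)) ∈ E)
    (T : C(X, ℝ) → F)
    (hTsup : ∀ f ∈ E, ∀ g ∈ E, T (f ⊔ g) = T f ⊔ T g)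
    (hTinf : ∀ f ∈ E, ∀ g ∈ E, T (f ⊓ g) = T f ⊓ T g)
    (hT1 : ∀ c : ℝ, T (c • (1 : C(X, ℝ))) = c • T 1) :
    ∀ ψ : F → ℝ,
      (∀ u v : F, ψ (u ⊔ v) = max (ψ u) (ψ v)) →
      (∀ u v : F, ψ (u ⊓ v) = min (ψ u) (ψ v)) →
      (∀ c : ℝ, ψ (c • T 1) = c) →
      ∃! x : X, ∀ g ∈ E, ψ (T g) = g x := by
  intro ψ hψsup hψinf hψ1
  have hsmul (c : ℝ) : ContinuousMap.const X c = c • (1 : C(X, ℝ)) := by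
    ext
    simp
  obtain ⟨x, hx⟩ := exists_forall_eq_eval_of_lattice_hom (E := (E : Set C(X, ℝ)))
    (φ := fun g => ψ (T g)) hsup hinf hdense
    (fun c => hsmul c ▸ E.smul_mem c hone)
    (fun f hf g hg => by rw [hTsup f hf g hg, hψsup])
    (fun f hf g hg => by rw [hTinf f hf g hg, hψinf])
    (fun c => by rw [hsmul, hT1, hψ1])
  refine ⟨x, hx, fun y hy => ?_⟩
  by_contra hne
  obtain ⟨g, hg, hgy, hgx⟩ := exists_mem_lt_and_lt_of_dense hdense hne 0 0
  have := hx g hg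
  have := hy g hg
  linarith
end
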